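/- Let (G, P, L) be a minimum counterexample to the following statement, minimizing |V(G)| + |E(G)| and then the sum of the list sizes: 'Every plane graph G with no 4-cycle, with outer face F, subpath P ⊆ F with at most three vertices, and (*,1)-list assignment L satisfying conditions (i)–(vi) is L-colorable.' Then every chord of the outer cycle F is bad, i.e., F contains no good chord; moreover, for every bad chord uv of F, neither u nor v belongs to V(P). -/

import Mathlib

open Set

namespace ChoosSep

/-- `G` has a cycle of length `n`. -/
def HasCycleLen {V : Type} (G : SimpleGraph V) (n : ℕ) : Prop :=
  ∃ (v : V) (c : G.Walk v v), c.IsCycle ∧ c.length = n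

/-- `G` has a proper coloring choosing each color from the list `L v`. -/
def ColorableWith {V : Type} (G : SimpleGraph V) (L : V → Finset ℕ) : Prop :=
  ∃ φ : V → ℕ, (∀ v, φ v ∈ L v) ∧ ∀ ⦃u v⦄, G.Adj u v → φ u ≠ φ v

/-- `G` is `(k,d)`-choosable: it has an `L`-coloring for every list assignment
giving each vertex at least `k` colors and any two adjacent vertices at most `d`
common colors. -/
def Choosable {V : Type} (G : SimpleGraph V) (k d : ℕ) : Prop :=
  ∀ L : V → Finset ℕ, (∀ v, k ≤ (L v).card) →
    (∀ ⦃u v⦄, G.Adj u v → ((L u) ∩ (L v)).card ≤ d) →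
    ColorableWith G L

/-- The closed straight segment between two points of the plane. -/
def seg (x y : ℝ × ℝ) : Set (ℝ × ℝ) := segment ℝ x y

/-- A straight-line plane embedding of `G`: vertices go to distinct points, edges are
drawn as straight segments, two distinct edges meet only in common endpoints, and no
vertex lies on the drawing of an edge it does not belong to.  By Fáry's theorem a
finite simple graph admits such an embedding iff it is planar. -/
structure PlaneEmb {V : Type} (G : SimpleGraph V) where
  pos : V → ℝ × ℝ
  inj : Function.Injective pos
  edges_meet : ∀ ⦃a b c d : V⦄, G.Adj a b → G.Adj c d → s(a, b) ≠ s(c, d) →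
    seg (pos a) (pos b) ∩ seg (pos c) (pos d) ⊆ ({pos a, pos b} ∩ {pos c, pos d} : Set (ℝ × ℝ))
  vertex_off : ∀ ⦃a b v : V⦄, G.Adj a b → v ≠ a → v ≠ b → pos v ∉ seg (pos a) (pos b)

/-- `G` is planar: it admits a plane embedding. -/
def IsPlanar {V : Type} (G : SimpleGraph V) : Prop := Nonempty (PlaneEmb G)

variable {V : Type} {G : SimpleGraph V}

/-- The drawing of the graph in the plane: all vertex points and all edge segments. -/
def PlaneEmb.drawing (E : PlaneEmb G) : Set (ℝ × ℝ) :=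
  Set.range E.pos ∪ ⋃ (a : V) (b : V) (_ : G.Adj a b), seg (E.pos a) (E.pos b)

/-- A face of the embedding: a connected component of the complement of the drawing. -/
def PlaneEmb.IsFace (E : PlaneEmb G) (C : Set (ℝ × ℝ)) : Prop :=
  ∃ q, q ∉ E.drawing ∧ C = connectedComponentIn E.drawingᶜ q

/-- The outer face: the unbounded face. -/
def PlaneEmb.IsOuterFace (E : PlaneEmb G) (C : Set (ℝ × ℝ)) : Prop :=
  E.IsFace C ∧ ¬ Bornology.IsBounded C

/-- The vertices lying on the boundary of the face `C`. -/
def PlaneEmb.onFace (E : PlaneEmb G) (C : Set (ℝ × ℝ)) : Set V :=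
  {v | E.pos v ∈ closure C}

/-- An edge of `G` lying on the boundary of the face `C`. -/
def PlaneEmb.BoundaryEdge (E : PlaneEmb G) (C : Set (ℝ × ℝ)) (u v : V) : Prop :=
  G.Adj u v ∧ seg (E.pos u) (E.pos v) ⊆ closure C

/-- `C` is a 3-face with (mutually adjacent) incident vertices `x`, `y`, `z`. -/
def PlaneEmb.IsTriFace (E : PlaneEmb G) (C : Set (ℝ × ℝ)) (x y z : V) : Prop :=
  E.IsFace C ∧ G.Adj x y ∧ G.Adj y z ∧ G.Adj x z ∧
    frontier C = seg (E.pos x) (E.pos y) ∪ seg (E.pos y) (E.pos z) ∪ seg (E.pos x) (E.pos z)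

/-- `C` is a 4-face with incident 4-cycle `w x y z`. -/
def PlaneEmb.IsQuadFace (E : PlaneEmb G) (C : Set (ℝ × ℝ)) (w x y z : V) : Prop :=
  E.IsFace C ∧ G.Adj w x ∧ G.Adj x y ∧ G.Adj y z ∧ G.Adj z w ∧ w ≠ y ∧ x ≠ z ∧
    frontier C = seg (E.pos w) (E.pos x) ∪ seg (E.pos x) (E.pos y) ∪
      seg (E.pos y) (E.pos z) ∪ seg (E.pos z) (E.pos w)

/-- `x z1 y z2` is a diamond: a 4-cycle formed by two adjacent 3-faces
`x y z1` and `x y z2` sharing the edge `x y`. -/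
def PlaneEmb.IsDiamond (E : PlaneEmb G) (x z1 y z2 : V) : Prop :=
  z1 ≠ z2 ∧ ∃ C1 C2 : Set (ℝ × ℝ), C1 ≠ C2 ∧ E.IsTriFace C1 x y z1 ∧ E.IsTriFace C2 x y z2

/-- The union of the three sides of the triangle `a b c`. -/
def triBoundary (a b c : ℝ × ℝ) : Set (ℝ × ℝ) := seg a b ∪ seg b c ∪ seg a c

/-- The open interior region of the triangle `a b c`: points off the triangle whose
connected component in the complement of the triangle is bounded. -/
def triInterior (a b c : ℝ × ℝ) : Set (ℝ × ℝ) :=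
  {p | p ∉ triBoundary a b c ∧
    Bornology.IsBounded (connectedComponentIn (triBoundary a b c)ᶜ p)}

/-- The degree of a vertex. -/
noncomputable def deg (G : SimpleGraph V) (v : V) : ℕ := Nat.card {u : V // G.Adj v u}

/-- `G` is 2-connected: connected and with no cutvertex. -/
def TwoConnected (G : SimpleGraph V) : Prop :=
  G.Connected ∧ ∀ v : V, (G.induce {u : V | u ≠ v}).Connected

/-- A configuration for Theorem 6: a plane graph with no 4-cycle, outer face `F`, a
precolored subpath `P` of the outer face with at most three vertices, and a
`(*,1)`-list assignment `L` satisfying conditions (i)–(vi). -/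
structure Cfg4 where
  n : ℕ
  G : SimpleGraph (Fin n)
  E : PlaneEmb G
  F : Set (ℝ × ℝ)
  P : List (Fin n)
  L : Fin n → Finset ℕ

namespace Cfg4

/-- All hypotheses of Theorem 6 hold for the configuration. -/
def Valid (C : Cfg4) : Prop :=
  (¬ HasCycleLen C.G 4) ∧
  C.E.IsOuterFace C.F ∧
  C.P.Nodup ∧ C.P.length ≤ 3 ∧
  (∀ v ∈ C.P, v ∈ C.E.onFace C.F) ∧
  C.P.Chain' (C.E.BoundaryEdge C.F) ∧
  (∀ v, 1 ≤ (C.L v).card) ∧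
  (∀ ⦃u v⦄, C.G.Adj u v → ((C.L u) ∩ (C.L v)).card ≤ 1) ∧
  (∀ v, v ∉ C.E.onFace C.F → 3 ≤ (C.L v).card) ∧
  (∀ v ∈ C.E.onFace C.F, v ∉ C.P → 2 ≤ (C.L v).card) ∧
  (∀ v ∈ C.P, (C.L v).card = 1) ∧
  (∀ ⦃u v⦄, C.G.Adj u v → (C.L u).card = 2 → (C.L v).card ≠ 2) ∧
  (∃ φ : Fin C.n → ℕ, (∀ v ∈ C.P, φ v ∈ C.L v) ∧
    ∀ ⦃u v⦄, u ∈ C.P → v ∈ C.P → C.G.Adj u v → φ u ≠ φ v) ∧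
  (∀ x, (C.L x).card = 2 → ∀ u ∈ C.P, ∀ v ∈ C.P, u ≠ v →
    C.G.Adj x u → C.G.Adj x v → False)

/-- The configuration admits an `L`-coloring. -/
def Colorable (C : Cfg4) : Prop := ColorableWith C.G C.L

/-- The quantity `|V(G)| + |E(G)|`. -/
noncomputable def measure (C : Cfg4) : ℕ := C.n + Nat.card ↥C.G.edgeSet

/-- The sum of the sizes of the lists. -/
def listSum (C : Cfg4) : ℕ := ∑ v, (C.L v).card

/-- `C` is a minimum counterexample to Theorem 6: it satisfies the hypotheses, has no
`L`-coloring, and minimizes `|V(G)| + |E(G)|` and then the sum of the list sizes among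
all such counterexamples. -/
def MinCounterexample (C : Cfg4) : Prop :=
  C.Valid ∧ ¬ C.Colorable ∧
    ∀ D : Cfg4, D.Valid → ¬ D.Colorable →
      C.measure ≤ D.measure ∧ (D.measure = C.measure → C.listSum ≤ D.listSum)

/-- `uv` is a chord of the outer cycle: an edge between two vertices of the outer
face that is not an edge of the outer face. -/
def IsChord (C : Cfg4) (u v : Fin C.n) : Prop :=
  C.G.Adj u v ∧ u ∈ C.E.onFace C.F ∧ v ∈ C.E.onFace C.F ∧ ¬ C.E.BoundaryEdge C.F u v

/-- A chord `uv` is bad if one of its `Q`-components is a triangle `u v x` with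
`|L(x)| = 2`: i.e. there is an `L2`-vertex `x` with `ux` and `xv` edges of the outer
cycle such that the triangle `u x v` encloses no vertex of `G`. -/
def IsBadChord (C : Cfg4) (u v : Fin C.n) : Prop :=
  C.IsChord u v ∧ ∃ x : Fin C.n, (C.L x).card = 2 ∧
    C.G.Adj u x ∧ C.G.Adj x v ∧
    C.E.BoundaryEdge C.F u x ∧ C.E.BoundaryEdge C.F x v ∧
    ∀ w : Fin C.n, C.E.pos w ∉ triInterior (C.E.pos u) (C.E.pos x) (C.E.pos v)

/-- `v0 v1 v2` is a 2-chord of the outer cycle. -/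
def Is2Chord (C : Cfg4) (v0 v1 v2 : Fin C.n) : Prop :=
  C.G.Adj v0 v1 ∧ C.G.Adj v1 v2 ∧ v0 ≠ v2 ∧
    v0 ∈ C.E.onFace C.F ∧ v2 ∈ C.E.onFace C.F ∧ v1 ∉ C.E.onFace C.F

/-- A 2-chord `v0 v1 v2` is separating if `v0 v2` is not an edge of the outer cycle. -/
def IsSep2Chord (C : Cfg4) (v0 v1 v2 : Fin C.n) : Prop :=
  C.Is2Chord v0 v1 v2 ∧ ¬ C.E.BoundaryEdge C.F v0 v2

/-- `v` is a middle vertex: it has degree two in the path `P`. -/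
def IsMiddle (C : Cfg4) (v : Fin C.n) : Prop :=
  ∃ a b, C.P = [a, v, b]

/-- `v0 v1 v2` is a path on the outer cycle `F`. -/
def IsOuterPath (C : Cfg4) (v0 v1 v2 : Fin C.n) : Prop :=
  v0 ≠ v2 ∧ C.E.BoundaryEdge C.F v0 v1 ∧ C.E.BoundaryEdge C.F v1 v2

end Cfg4

lemma isPreconnected_compl_closedBall_prod (R : ℝ) :
    IsPreconnected (Metric.closedBall (0 : ℝ × ℝ) R)ᶜ := by
  have h1 : Convex ℝ {p : ℝ × ℝ | R < p.1} :=
    convex_halfSpace_gt (LinearMap.fst ℝ ℝ ℝ).isLinear R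
  have h2 : Convex ℝ {p : ℝ × ℝ | R < p.2} :=
    convex_halfSpace_gt (LinearMap.snd ℝ ℝ ℝ).isLinear R
  have h3 : Convex ℝ {p : ℝ × ℝ | p.1 < -R} :=
    convex_halfSpace_lt (LinearMap.fst ℝ ℝ ℝ).isLinear (-R)
  have h4 : Convex ℝ {p : ℝ × ℝ | p.2 < -R} :=
    convex_halfSpace_lt (LinearMap.snd ℝ ℝ ℝ).isLinear (-R)
  have e : (Metric.closedBall (0 : ℝ × ℝ) R)ᶜ =
      (({p : ℝ × ℝ | R < p.1} ∪ {p | R < p.2}) ∪ {p | p.1 < -R}) ∪ {p | p.2 < -R} := by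
    ext p
    simp only [mem_compl_iff, Metric.mem_closedBall, dist_zero_right, Prod.norm_def,
      Real.norm_eq_abs, not_le, lt_sup_iff, lt_abs, mem_union, mem_ofPred_eq]
    constructor
    · rintro ((h | h) | (h | h))
      · exact Or.inl (Or.inl (Or.inl h))
      · exact Or.inl (Or.inr (by linarith))
      · exact Or.inl (Or.inl (Or.inr h))
      · exact Or.inr (by linarith)
    · rintro (((h | h) | h) | h)
      · exact Or.inl (Or.inl h)
      · exact Or.inr (Or.inl h)
      · exact Or.inl (Or.inr (by linarith))
      · exact Or.inr (Or.inr (by linarith))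
  rw [e]
  refine IsPreconnected.union' ⟨(-R - 1, -R - 1), Or.inr ?_, ?_⟩
    (IsPreconnected.union' ⟨(-R - 1, R + 1), Or.inr ?_, ?_⟩
      (IsPreconnected.union' ⟨(R + 1, R + 1), ?_, ?_⟩ h1.isPreconnected h2.isPreconnected)
      h3.isPreconnected) h4.isPreconnected <;> simp

lemma _root_.Convex.isPreconnected_compl_of_isCompact {K : Set (ℝ × ℝ)} (hK : Convex ℝ K)
    (hc : IsCompact K) : IsPreconnected Kᶜ := by
  rcases K.eq_empty_or_nonempty with rfl | ⟨x₀, hx₀⟩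
  · simpa using isPreconnected_univ
  obtain ⟨R, hR⟩ := hc.isBounded.subset_closedBall 0
  obtain ⟨q, hq⟩ : ∃ q, q ∉ Metric.closedBall (0 : ℝ × ℝ) R := by
    refine ⟨(R + 1, 0), ?_⟩
    simp only [Metric.mem_closedBall, dist_zero_right, Prod.norm_def, Real.norm_eq_abs, not_le,
      lt_sup_iff]
    exact Or.inl (lt_of_lt_of_le (by linarith) (le_abs_self _))
  refine isPreconnected_of_forall q fun y hy => ?_
  obtain ⟨f, c, hfc, hcy⟩ := geometric_hahn_banach_closed_point hK hc.isClosed hy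
  refine ⟨{x | c < f x} ∪ (Metric.closedBall 0 R)ᶜ, ?_, Or.inr hq, Or.inl hcy, ?_⟩
  · rintro z (hz | hz) hzK
    · exact absurd (hfc z hzK) (not_lt.2 (le_of_lt hz))
    · exact hz (hR hzK)
  · have hH : Convex ℝ {x | c < f x} := convex_halfSpace_gt f.toLinearMap.isLinear c
    refine IsPreconnected.union' ?_ hH.isPreconnected (isPreconnected_compl_closedBall_prod R)
    set w := y - x₀ with hw
    have hfw : 0 < f w := by
      rw [hw, map_sub]; linarith [hfc x₀ hx₀]
    have hw0 : 0 < ‖w‖ := by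
      rw [norm_pos_iff]; rintro h; rw [h, map_zero] at hfw; exact lt_irrefl _ hfw
    set t : ℝ := (|R| + ‖y‖ + 1) / ‖w‖ with ht
    have ht0 : 0 ≤ t := by positivity
    refine ⟨y + t • w, ?_, ?_⟩
    · simp only [mem_ofPred_eq, map_add, map_smul, smul_eq_mul]
      nlinarith [mul_nonneg ht0 hfw.le]
    · simp only [mem_compl_iff, Metric.mem_closedBall, dist_zero_right, not_le]
      have h1 : ‖t • w‖ = |R| + ‖y‖ + 1 := by
        rw [norm_smul, Real.norm_of_nonneg ht0, ht, div_mul_cancel₀ _ hw0.ne']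
      have h2 : ‖t • w‖ ≤ ‖y + t • w‖ + ‖y‖ := by
        have := norm_sub_le (y + t • w) y
        simpa using this
      linarith [le_abs_self R]

/-- The union of the unbounded components of the complement of `D`. -/
def outer (D : Set (ℝ × ℝ)) : Set (ℝ × ℝ) :=
  {q | q ∉ D ∧ ¬ Bornology.IsBounded (connectedComponentIn Dᶜ q)}

lemma outer_anti {D D' : Set (ℝ × ℝ)} (h : D ⊆ D') : outer D' ⊆ outer D := fun q hq =>
  ⟨fun hD => hq.1 (h hD), fun hb =>
    hq.2 (hb.subset (connectedComponentIn_mono q (compl_subset_compl.2 h)))⟩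

lemma subset_outer {D X : Set (ℝ × ℝ)} (hX : IsPreconnected X) (hD : Disjoint X D)
    (hne : (X ∩ outer D).Nonempty) : X ⊆ outer D := by
  obtain ⟨y, hyX, hyD, hyb⟩ := hne
  have hXD : X ⊆ Dᶜ := fun z hz hzD => disjoint_left.1 hD hz hzD
  intro x hx
  have : x ∈ connectedComponentIn Dᶜ y := hX.subset_connectedComponentIn hyX hXD hx
  exact ⟨hXD hx, by rwa [← connectedComponentIn_eq this]⟩

lemma subset_outer_of_unbounded {D X : Set (ℝ × ℝ)} (hX : IsPreconnected X) (hD : Disjoint X D)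
    (hne : ¬ Bornology.IsBounded X) : X ⊆ outer D := by
  have hXD : X ⊆ Dᶜ := fun z hz hzD => disjoint_left.1 hD hz hzD
  exact fun x hx => ⟨hXD hx, fun hb => hne (hb.subset (hX.subset_connectedComponentIn hx hXD))⟩

lemma connectedComponentIn_eq_outer {D : Set (ℝ × ℝ)} (hD : Bornology.IsBounded D) {q : ℝ × ℝ}
    (hq : q ∈ outer D) : connectedComponentIn Dᶜ q = outer D := by
  obtain ⟨R, hR⟩ := hD.subset_closedBall 0
  have key : ∀ p ∈ outer D, ∃ z ∈ connectedComponentIn Dᶜ p, z ∉ Metric.closedBall 0 R := by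
    intro p hp
    by_contra! h
    exact hp.2 (Metric.isBounded_closedBall.subset h)
  have hB : (Metric.closedBall (0 : ℝ × ℝ) R)ᶜ ⊆ Dᶜ := compl_subset_compl.2 hR
  apply subset_antisymm
  · exact subset_outer isPreconnected_connectedComponentIn
      (disjoint_left.2 fun z hz hzD => connectedComponentIn_subset _ _ hz hzD)
      ⟨q, mem_connectedComponentIn hq.1, hq⟩
  · intro p hp
    obtain ⟨z, hz, hzB⟩ := key p hp
    obtain ⟨y, hy, hyB⟩ := key q hq
    have h1 := (isPreconnected_compl_closedBall_prod R).subset_connectedComponentIn hyB hB hzB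
    rw [connectedComponentIn_eq hy, connectedComponentIn_eq h1, ← connectedComponentIn_eq hz]
    exact mem_connectedComponentIn hp.1

lemma isPreconnected_outer {D : Set (ℝ × ℝ)} (hD : Bornology.IsBounded D) :
    IsPreconnected (outer D) := by
  rcases (outer D).eq_empty_or_nonempty with h | ⟨q, hq⟩
  · rw [h]; exact isPreconnected_empty
  · rw [← connectedComponentIn_eq_outer hD hq]; exact isPreconnected_connectedComponentIn

lemma isOpen_outer {D : Set (ℝ × ℝ)} (hD : IsCompact D) : IsOpen (outer D) := by
  rcases (outer D).eq_empty_or_nonempty with h | ⟨q, hq⟩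
  · rw [h]; exact isOpen_empty
  · rw [← connectedComponentIn_eq_outer hD.isBounded hq]
    exact hD.isClosed.isOpen_compl.connectedComponentIn

lemma not_isBounded_compl {D : Set (ℝ × ℝ)} (hD : Bornology.IsBounded D) :
    ¬ Bornology.IsBounded Dᶜ := by
  intro h
  have h2 := hD.union h
  rw [union_compl_self] at h2
  exact NormedSpace.unbounded_univ ℝ (ℝ × ℝ) h2

lemma exists_mem_outer {D : Set (ℝ × ℝ)} (hD : Bornology.IsBounded D) : (outer D).Nonempty := by
  obtain ⟨R, hR⟩ := hD.subset_closedBall 0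
  have hB := not_isBounded_compl (Metric.isBounded_closedBall (x := (0 : ℝ × ℝ)) (r := R))
  have : (Metric.closedBall (0 : ℝ × ℝ) R)ᶜ.Nonempty := by
    rw [nonempty_iff_ne_empty]; rintro h; rw [h] at hB; exact hB Bornology.isBounded_empty
  exact this.mono (subset_outer_of_unbounded (isPreconnected_compl_closedBall_prod R)
    (disjoint_left.2 fun z hz hzD => hz (hR hzD)) hB)

lemma not_isBounded_outer {D : Set (ℝ × ℝ)} (hD : Bornology.IsBounded D) :
    ¬ Bornology.IsBounded (outer D) := by
  obtain ⟨q, hq⟩ := exists_mem_outer hD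
  rw [← connectedComponentIn_eq_outer hD hq]; exact hq.2

/-- The Möbius function `z ↦ (z - p) / (z - q)` has a continuous logarithm on `γ`. -/
def HasLogOn (γ : Set ℂ) (p q : ℂ) : Prop :=
  ∃ g : ℂ → ℂ, ContinuousOn g γ ∧ ∀ z ∈ γ, Complex.exp (g z) = (z - p) / (z - q)

lemma hasLogOn_of_slitPlane {γ : Set ℂ} {p q : ℂ} (hq : q ∉ γ)
    (h : ∀ z ∈ γ, (z - p) / (z - q) ∈ Complex.slitPlane) :
    ContinuousOn (fun z => Complex.log ((z - p) / (z - q))) γ := by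
  refine ContinuousOn.clog (ContinuousOn.div (by fun_prop) (by fun_prop) ?_) h
  intro z hz h0
  exact hq (by rwa [← sub_eq_zero.1 h0])

lemma hasLogOn_of_mem_component {γ : Set ℂ} (hγ : IsClosed γ) {p q : ℂ}
    {W : Set ℂ} (hW : IsPreconnected W) (hWγ : W ⊆ γᶜ) (hp : p ∈ W) (hq : q ∈ W) :
    HasLogOn γ p q := by
  refine hW.induction₂ (HasLogOn γ) ?_ ?_ ?_ hp hq
  · intro x hx
    have hxγ : γᶜ ∈ nhds x := hγ.isOpen_compl.mem_nhds (hWγ hx)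
    obtain ⟨r, hr, hball⟩ := Metric.mem_nhds_iff.1 hxγ
    refine nhdsWithin_le_nhds ?_
    filter_upwards [Metric.ball_mem_nhds x (half_pos hr)] with y hy
    have hyγ : y ∉ γ := fun h => hball (Metric.ball_subset_ball (by linarith) hy) h
    have hne : ∀ z ∈ γ, z - y ≠ 0 := fun z hz h0 => hyγ (by rwa [← sub_eq_zero.1 h0])
    have hxne : ∀ z ∈ γ, z - x ≠ 0 := fun z hz h0 => hWγ hx (by rwa [← sub_eq_zero.1 h0])
    refine ⟨_, hasLogOn_of_slitPlane hyγ ?_, fun z hz => Complex.exp_log ?_⟩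
    · intro z hz
      have hzx : r ≤ dist z x := by
        by_contra! h
        exact hball h hz
      have hyx : dist y x < r / 2 := hy
      have hzy : r / 2 < ‖z - y‖ := by
        rw [← dist_eq_norm]
        linarith [dist_triangle z y x]
      have hlt : ‖(z - x) / (z - y) - 1‖ < 1 := by
        rw [div_sub_one (hne z hz), norm_div, div_lt_one (by linarith)]
        have : z - x - (z - y) = y - x := by ring
        rw [this, ← dist_eq_norm]; linarith
      rw [Complex.mem_slitPlane_iff]; left
      have := (abs_le.1 (Complex.abs_re_le_norm ((z - x) / (z - y) - 1))).1
      simp only [Complex.sub_re, Complex.one_re] at this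
      linarith
    · exact div_ne_zero (hxne z hz) (hne z hz)
  · rintro x y z hx hy hz ⟨g, hg, hg'⟩ ⟨g2, hg2, hg2'⟩
    refine ⟨fun z => g z + g2 z, hg.add hg2, fun w hw => ?_⟩
    have h1 : w - y ≠ 0 := fun h0 => hWγ hy (by rwa [← sub_eq_zero.1 h0])
    rw [Complex.exp_add, hg' w hw, hg2' w hw, div_mul_div_cancel₀ h1]
  · rintro x y hx hy ⟨g, hg, hg'⟩
    refine ⟨fun z => - g z, hg.neg, fun w hw => ?_⟩
    rw [Complex.exp_neg, hg' w hw, inv_div]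

lemma sub_eq_sub_of_exp_eq {γ : Set ℂ} (hγ : IsPreconnected γ) {g h : ℂ → ℂ}
    (hg : ContinuousOn g γ) (hh : ContinuousOn h γ)
    (he : ∀ z ∈ γ, Complex.exp (g z) = Complex.exp (h z)) {a b : ℂ} (ha : a ∈ γ) (hb : b ∈ γ) :
    g a - h a = g b - h b := by
  have hint : ∀ z ∈ γ, ∃ n : ℤ, g z - h z = n * (2 * Real.pi * Complex.I) := by
    intro z hz
    obtain ⟨n, hn⟩ := Complex.exp_eq_exp_iff_exists_int.1 (he z hz)
    exact ⟨n, by rw [hn]; ring⟩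
  have hpi : (2 * Real.pi * Complex.I : ℂ) ≠ 0 := Complex.two_pi_I_ne_zero
  set f : ℂ → ℝ := fun z => ((g z - h z) / (2 * Real.pi * Complex.I)).re with hf
  have hfc : ContinuousOn f γ :=
    Complex.continuous_re.comp_continuousOn ((hg.sub hh).div_const _)
  have hfi : ∀ z ∈ γ, ∀ n : ℤ, g z - h z = n * (2 * Real.pi * Complex.I) → f z = n := by
    intro z hz n hn
    simp only [hf]; rw [hn, mul_div_cancel_right₀ _ hpi, Complex.intCast_re]
  have hmaps : MapsTo f γ (range ((↑) : ℤ → ℝ)) := fun z hz => by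
    obtain ⟨n, hn⟩ := hint z hz
    exact ⟨n, (hfi z hz n hn).symm⟩
  have hdisc : IsTotallyDisconnected (range ((↑) : ℤ → ℝ)) :=
    (countable_range _).isTotallyDisconnected
  have hsub := hdisc (f '' γ) hmaps.image_subset (hγ.image f hfc)
  obtain ⟨n, hn⟩ := hint a ha
  obtain ⟨m, hm⟩ := hint b hb
  have := hsub (mem_image_of_mem f ha) (mem_image_of_mem f hb)
  rw [hfi a ha n hn, hfi b hb m hm] at this
  rw [hn, hm, Int.cast_injective this]

/-- Two points on different sides of the segment `[-1, 1]` are separated by the union of this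
segment and any closed connected set joining its ends that stays away from both of them. -/
lemma separated_by_segment {c : Set ℂ} (hcc : IsClosed c) (hc : IsPreconnected c)
    (h1 : (1 : ℂ) ∈ c) (hm1 : (-1 : ℂ) ∈ c) {ε : ℝ} (hε : 0 < ε)
    (hcε : ∀ s : ℝ, |s| ≤ ε → (s * Complex.I : ℂ) ∉ c) {W : Set ℂ} (hW : IsPreconnected W)
    (hWc : Disjoint W c) (hWs : ∀ t : ℝ, |t| ≤ 1 → (t : ℂ) ∉ W)
    (hp : (ε * Complex.I : ℂ) ∈ W) : (-(ε * Complex.I) : ℂ) ∉ W := by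
  intro hq
  set p : ℂ := ε * Complex.I with hpdef
  set S : Set ℂ := (fun t : ℝ => (t : ℂ)) '' Icc (-1) 1 with hS
  have hSc : IsCompact S := isCompact_Icc.image Complex.continuous_ofReal
  have hSp : IsPreconnected S := isPreconnected_Icc.image _ Complex.continuous_ofReal.continuousOn
  have hWγ : W ⊆ (c ∪ S)ᶜ := by
    rintro z hz (h | ⟨t, ht, rfl⟩)
    · exact disjoint_left.1 hWc hz h
    · exact hWs t (abs_le.2 ht) hz
  obtain ⟨g, hg, hge⟩ := hasLogOn_of_mem_component (hcc.union hSc.isClosed) hW hWγ hp hq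
  simp only [sub_neg_eq_add] at hge
  have hne : ∀ z ∈ c ∪ S, z - p ≠ 0 := fun z hz h0 =>
    hWγ hp (by rwa [← sub_eq_zero.1 h0])
  have hne' : ∀ z ∈ c ∪ S, z + p ≠ 0 := fun z hz h0 =>
    hWγ hq (by rwa [← eq_neg_of_add_eq_zero_left h0])
  have hdiv : ContinuousOn (fun z => (z - p) / (z + p)) (c ∪ S) :=
    ContinuousOn.div (by fun_prop) (by fun_prop) hne'
  have hlog1 : ContinuousOn (fun z => Complex.log ((z - p) / (z + p))) c := by
    refine ContinuousOn.clog (hdiv.mono subset_union_left) ?_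
    intro z hz
    by_contra hsl
    rw [Complex.mem_slitPlane_iff_not_le_zero, not_not, Complex.nonpos_iff] at hsl
    set r := ((z - p) / (z + p)).re with hr
    have hzr : (z - p) / (z + p) = r := Complex.ext rfl (by simpa using hsl.2)
    rw [div_eq_iff (hne' z (Or.inl hz))] at hzr
    have h1r : (1 - r : ℝ) ≠ 0 := by linarith [hsl.1]
    have h1rc : (1 - r : ℂ) ≠ 0 := by exact_mod_cast h1r
    have hz2 : z = ((1 + r) / (1 - r) * ε : ℝ) * Complex.I := by
      have : z * (1 - r) = (1 + r) * p := by linear_combination hzr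
      push_cast
      rw [div_mul_eq_mul_div, div_mul_eq_mul_div, eq_div_iff h1rc, this, hpdef]; ring
    refine hcε _ ?_ (hz2 ▸ hz)
    rw [abs_mul, abs_of_pos hε]
    refine mul_le_of_le_one_left hε.le ?_
    rw [abs_div, div_le_one (abs_pos.2 h1r), abs_of_pos (by linarith [hsl.1] : 0 < 1 - r), abs_le]
    constructor <;> linarith [hsl.1]
  have hlog2 : ContinuousOn (fun z => Complex.log (-((z - p) / (z + p)))) S := by
    refine ContinuousOn.clog (hdiv.mono subset_union_right).neg ?_
    rintro z ⟨t, ht, rfl⟩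
    have hpos : 0 < t ^ 2 + ε ^ 2 := by positivity
    have : -(((t : ℂ) - p) / (t + p)) =
        ((ε ^ 2 - t ^ 2) / (t ^ 2 + ε ^ 2) : ℝ) + ((2 * t * ε) / (t ^ 2 + ε ^ 2) : ℝ) *
          Complex.I := by
      have hne2 : ((t : ℂ) ^ 2 + ε ^ 2) ≠ 0 := by exact_mod_cast hpos.ne'
      rw [← neg_div, div_eq_iff (hne' _ (Or.inr ⟨t, ht, rfl⟩)), hpdef]
      push_cast
      field_simp
      ring_nf
      simp only [show Complex.I ^ 2 = -1 from Complex.I_sq]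
      ring
    rw [this, Complex.mem_slitPlane_iff]
    simp only [Complex.add_re, Complex.ofReal_re, Complex.mul_re, Complex.I_re, mul_zero,
      Complex.ofReal_im, Complex.I_im, mul_one, sub_self, add_zero, Complex.add_im,
      Complex.mul_im, zero_add]
    rcases eq_or_ne t 0 with rfl | h0
    · left; apply div_pos <;> nlinarith
    · right; simp [h0, hε.ne', hpos.ne']
  have e1 := sub_eq_sub_of_exp_eq hc (hg.mono subset_union_left) hlog1 (fun z hz => by
    rw [hge z (Or.inl hz), Complex.exp_log
      (div_ne_zero (hne z (Or.inl hz)) (hne' z (Or.inl hz)))]) h1 hm1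
  have hi : Complex.exp (Real.pi * Complex.I) = -1 := Complex.exp_pi_mul_I
  have m1 : (1 : ℂ) ∈ S := ⟨1, by norm_num, by simp⟩
  have m2 : (-1 : ℂ) ∈ S := ⟨-1, by norm_num, by simp⟩
  have e2 := sub_eq_sub_of_exp_eq hSp (hg.mono subset_union_right)
    (hlog2.add continuousOn_const (g := fun _ => Real.pi * Complex.I)) (fun z hz => by
    rw [hge z (Or.inr hz), Pi.add_apply, Complex.exp_add, Complex.exp_log (neg_ne_zero.2
      (div_ne_zero (hne z (Or.inr hz)) (hne' z (Or.inr hz)))), hi]; ring) m1 m2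
  have hpos : 0 < 1 + ε ^ 2 := by positivity
  have hne2 : (1 + (ε : ℂ) ^ 2) ≠ 0 := by exact_mod_cast hpos.ne'
  have v1 : (1 - p) / (1 + p) = ((1 - ε ^ 2) / (1 + ε ^ 2) : ℝ) +
      (-(2 * ε) / (1 + ε ^ 2) : ℝ) * Complex.I := by
    rw [div_eq_iff (hne' _ (Or.inl h1)), hpdef]
    push_cast
    field_simp
    ring_nf
    simp only [show Complex.I ^ 2 = -1 from Complex.I_sq]
    ring
  have v2 : (-1 - p) / (-1 + p) = ((1 - ε ^ 2) / (1 + ε ^ 2) : ℝ) +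
      ((2 * ε) / (1 + ε ^ 2) : ℝ) * Complex.I := by
    rw [div_eq_iff (hne' _ (Or.inl hm1)), hpdef]
    push_cast
    field_simp
    ring_nf
    simp only [show Complex.I ^ 2 = -1 from Complex.I_sq]
    ring
  have i1 : ((1 - p) / (1 + p)).im < 0 := by
    rw [v1]; simp only [Complex.add_im, Complex.ofReal_im, Complex.mul_im, Complex.ofReal_re,
      Complex.I_im, Complex.I_re, mul_one, mul_zero, add_zero, zero_add]
    exact div_neg_of_neg_of_pos (by linarith) hpos
  have i2 : 0 < ((-1 - p) / (-1 + p)).im := by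
    rw [v2]; simp only [Complex.add_im, Complex.ofReal_im, Complex.mul_im, Complex.ofReal_re,
      Complex.I_im, Complex.I_re, mul_one, mul_zero, add_zero, zero_add]
    exact div_pos (by linarith) hpos
  have l1 : Complex.log (-((1 - p) / (1 + p))) = Complex.log ((1 - p) / (1 + p)) +
      Real.pi * Complex.I := by
    simp only [Complex.log, norm_neg, Complex.arg_neg_eq_arg_add_pi_of_im_neg i1]
    push_cast; ring
  have l2 : Complex.log (-((-1 - p) / (-1 + p))) = Complex.log ((-1 - p) / (-1 + p)) -
      Real.pi * Complex.I := by
    simp only [Complex.log, norm_neg, Complex.arg_neg_eq_arg_sub_pi_of_im_pos i2]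
    push_cast; ring
  simp only [Pi.add_apply] at e2
  rw [l1, l2] at e2
  have : (2 * Real.pi * Complex.I : ℂ) = 0 := by linear_combination e1 - e2
  exact Complex.two_pi_I_ne_zero this

/-- `W` is a connected component of the complement of `c ∪ S` whose closure contains `S`. -/
structure IsSide {X : Type} [TopologicalSpace X] (c S W : Set X) : Prop where
  isPreconnected : IsPreconnected W
  isOpen : IsOpen W
  disjoint : Disjoint W (c ∪ S)
  maximal : ∀ Y : Set X, IsPreconnected Y → Disjoint Y (c ∪ S) → (Y ∩ W).Nonempty → Y ⊆ W
  subset_closure : S ⊆ closure W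

lemma IsSide.image {X Y : Type} [TopologicalSpace X] [TopologicalSpace Y] (h : X ≃ₜ Y)
    {c S W : Set X} (hW : IsSide c S W) : IsSide (h '' c) (h '' S) (h '' W) where
  isPreconnected := hW.isPreconnected.image _ h.continuous.continuousOn
  isOpen := h.isOpenMap _ hW.isOpen
  disjoint := by
    rw [← image_union]; exact (disjoint_image_iff h.injective).2 hW.disjoint
  maximal := by
    intro T hT hd hne
    have e : ∀ A : Set X, h.symm '' (h '' A) = A := fun A => h.symm_image_image A
    have h1 := hW.maximal (h.symm '' T) (hT.image _ h.symm.continuous.continuousOn) ?_ ?_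
    · rw [← h.image_symm_image T]
      exact image_mono h1
    · rw [← image_union] at hd
      have := (disjoint_image_iff h.symm.injective).2 hd
      rwa [e] at this
    · have := hne.image h.symm
      rwa [image_inter h.symm.injective, e] at this
  subset_closure := by
    rw [← h.image_closure]; exact image_mono hW.subset_closure

/-- The segment `[-1, 1]` of the real axis. -/
def unitSeg : Set ℂ := (fun t : ℝ => (t : ℂ)) '' Icc (-1) 1

lemma isCompact_unitSeg : IsCompact unitSeg := isCompact_Icc.image Complex.continuous_ofReal

lemma isSide_component {c : Set ℂ} (hcc : IsClosed c) (hct : ∀ t : ℝ, |t| < 1 → (t : ℂ) ∉ c)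
    {ε : ℝ} (hε : 0 < ε) (hcε : ∀ s : ℝ, |s| ≤ ε → (s * Complex.I : ℂ) ∉ c) {σ : ℝ}
    (hσ : |σ| = 1) :
    IsSide c unitSeg (connectedComponentIn (c ∪ unitSeg)ᶜ (σ * ε * Complex.I)) := by
  have hclosed : IsClosed (c ∪ unitSeg) := hcc.union isCompact_unitSeg.isClosed
  have hσ0 : σ ≠ 0 := by rintro rfl; simp at hσ
  have hσσ : σ * σ = 1 := by rw [← abs_mul_abs_self, hσ, one_mul]
  set W := connectedComponentIn (c ∪ unitSeg)ᶜ (σ * ε * Complex.I) with hW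
  have hmax : ∀ Y : Set ℂ, IsPreconnected Y → Disjoint Y (c ∪ unitSeg) → (Y ∩ W).Nonempty →
      Y ⊆ W := by
    rintro Y hY hd ⟨y, hyY, hyW⟩
    rw [hW, connectedComponentIn_eq hyW]
    exact hY.subset_connectedComponentIn hyY (fun z hz hz' => disjoint_left.1 hd hz hz')
  have hseg : ∀ z ∈ unitSeg, z.im = 0 := by
    rintro _ ⟨t, -, rfl⟩; exact Complex.ofReal_im t
  have hbase : (σ * ε * Complex.I : ℂ) ∈ W := by
    refine mem_connectedComponentIn ?_
    rintro (h | h)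
    · refine hcε (σ * ε) ?_ (by push_cast; exact h)
      rw [abs_mul, hσ, one_mul, abs_of_pos hε]
    · have := hseg _ h
      simp [hσ0, hε.ne'] at this
  have im_lin : IsLinearMap ℝ (fun z : ℂ => σ * z.im) :=
    ⟨fun x y => by simp [mul_add], fun a x => by simp; ring⟩
  have hvert : {z : ℂ | z.re = 0 ∧ 0 < σ * z.im ∧ σ * z.im ≤ ε} ⊆ W := by
    refine hmax _ ?_ ?_ ⟨σ * ε * Complex.I, ?_, hbase⟩
    · refine Convex.isPreconnected ?_
      refine Convex.inter ?_ (Convex.inter (convex_halfSpace_gt im_lin 0)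
        (convex_halfSpace_le im_lin ε))
      exact convex_hyperplane (f := fun z : ℂ => z.re)
        ⟨fun x y => Complex.add_re x y, fun a x => by simp⟩ 0
    · refine disjoint_left.2 ?_
      rintro z ⟨hz0, hz1, hz2⟩ (h | h)
      · refine hcε z.im ?_ ?_
        · rw [abs_le]
          rcases (abs_eq zero_le_one).1 hσ with h | h <;> subst h <;> constructor <;> linarith
        · convert h using 1
          apply Complex.ext <;> simp [hz0]
      · rw [hseg z h] at hz1; simp at hz1
    · refine ⟨by simp, ?_, ?_⟩ <;> simp [← mul_assoc, hσσ, hε]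
  have hopen : ∀ t : ℝ, |t| < 1 → (t : ℂ) ∈ closure W := by
    intro t ht
    have hK : IsCompact ((fun t : ℝ => (t : ℂ)) '' Icc (-|t|) |t|) :=
      isCompact_Icc.image Complex.continuous_ofReal
    obtain ⟨δ, hδ, hsub⟩ := hK.exists_thickening_subset_open hcc.isOpen_compl (by
      rintro _ ⟨r, hr, rfl⟩
      exact hct r (lt_of_le_of_lt (abs_le.2 hr) ht))
    have hstrip : {z : ℂ | (-|t| ≤ z.re ∧ z.re ≤ |t|) ∧ 0 < σ * z.im ∧ σ * z.im < min δ ε} ⊆ W := by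
      refine hmax _ ?_ ?_ ⟨σ * (min δ ε / 2 : ℝ) * Complex.I, ?_, ?_⟩
      · refine Convex.isPreconnected ?_
        have re_lin : IsLinearMap ℝ (fun z : ℂ => z.re) :=
          ⟨fun x y => Complex.add_re x y, fun a x => by simp⟩
        exact Convex.inter (Convex.inter (convex_halfSpace_ge re_lin _)
          (convex_halfSpace_le re_lin _)) (Convex.inter (convex_halfSpace_gt im_lin 0)
          (convex_halfSpace_lt im_lin _))
      · refine disjoint_left.2 ?_
        rintro z ⟨hz0, hz1, hz2⟩ (h | h)
        · refine hsub ?_ h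
          rw [Metric.mem_thickening_iff]
          refine ⟨(z.re : ℂ), ⟨z.re, hz0, rfl⟩, ?_⟩
          rw [Complex.dist_of_re_eq (by simp)]
          simp only [Complex.ofReal_im, Real.dist_eq, sub_zero]
          have : |z.im| = |σ * z.im| := by rw [abs_mul, hσ, one_mul]
          rw [this, abs_of_pos hz1]
          exact lt_of_lt_of_le hz2 (min_le_left _ _)
        · rw [hseg z h] at hz1; simp at hz1
      · have : 0 < min δ ε := lt_min hδ hε
        refine ⟨by simp, ?_, ?_⟩ <;> simp [← mul_assoc, hσσ, -lt_inf_iff, this]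
      · have : 0 < min δ ε := lt_min hδ hε
        have h2 : min δ ε ≤ ε := min_le_right _ _
        refine hvert ⟨by simp, ?_, ?_⟩ 
        · simp [← mul_assoc, hσσ, -lt_inf_iff, this]
        · simp only [Complex.mul_im, Complex.mul_re, Complex.ofReal_re, Complex.ofReal_im,
            Complex.I_re, Complex.I_im]
          nlinarith
    rw [Metric.mem_closure_iff]
    intro r hr
    have hm : 0 < min (min δ ε) r := lt_min (lt_min hδ hε) hr
    set s := min (min δ ε) r / 2 with hs
    have hs0 : 0 < s := by positivity
    have hs1 : s < min δ ε := by linarith [min_le_left (min δ ε) r]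
    have hs2 : s < r := by linarith [min_le_right (min δ ε) r]
    refine ⟨t + σ * s * Complex.I, hstrip ⟨?_, ?_, ?_⟩, ?_⟩
    · simp [neg_abs_le, le_abs_self]
    · simp [← mul_assoc, hσσ, hs0]
    · simp [← mul_assoc, hσσ, -lt_inf_iff, hs1]
    · rw [Complex.dist_of_re_eq (by simp), Real.dist_eq]
      simp [abs_mul, hσ, abs_of_pos hs0, hs2]
  refine ⟨isPreconnected_connectedComponentIn, hclosed.isOpen_compl.connectedComponentIn,
    disjoint_left.2 fun z hz hz' => connectedComponentIn_subset _ _ hz hz', hmax, ?_⟩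
  rintro _ ⟨t, ht, rfl⟩
  have : MapsTo (fun t : ℝ => (t : ℂ)) (closure (Ioo (-1) 1)) (closure (closure W)) :=
    MapsTo.closure (fun t ht => hopen t (abs_lt.2 ht)) Complex.continuous_ofReal
  rw [closure_closure, closure_Ioo (by norm_num)] at this
  exact this ht

lemma exists_two_sides_unitSeg {c : Set ℂ} (hcc : IsClosed c) (hc : IsPreconnected c)
    (h1 : (1 : ℂ) ∈ c) (hm1 : (-1 : ℂ) ∈ c) (hct : ∀ t : ℝ, |t| < 1 → (t : ℂ) ∉ c) :
    ∃ W₁ W₂, IsSide c unitSeg W₁ ∧ IsSide c unitSeg W₂ ∧ Disjoint W₁ W₂ := by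
  obtain ⟨δ, hδ, hball⟩ := Metric.mem_nhds_iff.1
    (hcc.isOpen_compl.mem_nhds (x := (0 : ℂ)) (by simpa using hct 0 (by simp)))
  have hcε : ∀ s : ℝ, |s| ≤ δ / 2 → (s * Complex.I : ℂ) ∉ c := by
    intro s hs
    refine hball ?_
    simp only [Metric.mem_ball, dist_zero_right, norm_mul, Complex.norm_real, Real.norm_eq_abs,
      Complex.norm_I, mul_one]
    linarith
  have hε : 0 < δ / 2 := half_pos hδ
  have s1 := isSide_component hcc hct hε hcε (σ := 1) (by simp)
  have s2 := isSide_component hcc hct hε hcε (σ := -1) (by simp)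
  refine ⟨_, _, s1, s2, ?_⟩
  have hmem : ∀ σ : ℝ, |σ| = 1 → (σ * (δ / 2 : ℝ) * Complex.I : ℂ) ∈
      connectedComponentIn (c ∪ unitSeg)ᶜ (σ * (δ / 2 : ℝ) * Complex.I) := by
    intro σ hσ
    refine mem_connectedComponentIn ?_
    rintro (h | ⟨t, -, ht⟩)
    · refine hcε (σ * (δ / 2)) ?_ (by push_cast at h ⊢; exact h)
      rw [abs_mul, hσ, one_mul, abs_of_pos hε]
    · have := congrArg Complex.im ht
      have hσ0 : σ ≠ 0 := by rintro rfl; simp at hσ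
      simp [hσ0, hδ.ne', -Complex.ofReal_div] at this
  by_contra hne
  rw [not_disjoint_iff] at hne
  obtain ⟨z, hz1, hz2⟩ := hne
  have hsub := s2.maximal _ s1.isPreconnected s1.disjoint ⟨z, hz1, hz2⟩
  have hsub' := s1.maximal _ s2.isPreconnected s2.disjoint ⟨z, hz2, hz1⟩
  have m1 := hmem 1 (by simp)
  have m2 := hsub' (hmem (-1) (by simp))
  refine separated_by_segment hcc hc h1 hm1 hε hcε s1.isPreconnected
    (s1.disjoint.mono_right subset_union_left) ?_ ?_ ?_
  · intro t ht htW
    exact disjoint_left.1 s1.disjoint htW (Or.inr ⟨t, abs_le.1 ht, rfl⟩)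
  · convert m1 using 1; simp
  · convert m2 using 1; simp

/-- The similarity of the plane taking `-1` to `u` and `1` to `v`. -/
noncomputable def frame (u v : ℝ × ℝ) (h : u ≠ v) : ℂ ≃ₜ ℝ × ℝ :=
  have hne : (Complex.equivRealProd.symm v - Complex.equivRealProd.symm u) / 2 ≠ 0 := by
    refine div_ne_zero (sub_ne_zero.2 fun e => h ?_) two_ne_zero
    exact (Complex.equivRealProd.symm.injective e).symm
  ((Homeomorph.mulLeft₀ _ hne).trans
    (Homeomorph.addRight
      ((Complex.equivRealProd.symm v + Complex.equivRealProd.symm u) / 2))).trans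
    Complex.equivRealProdCLM.toHomeomorph

lemma frame_ofReal (u v : ℝ × ℝ) (h : u ≠ v) (t : ℝ) :
    frame u v h t = ((1 - t) / 2) • u + ((1 + t) / 2) • v := by
  have e : ∀ z : ℂ, Complex.equivRealProdCLM.toHomeomorph z = (z.re, z.im) := fun z => rfl
  have h2 : (2 : ℂ) = (2 : ℝ) := by norm_num
  apply Prod.ext <;>
  simp only [frame, Homeomorph.trans_apply, e] <;>
  simp [h2, -Complex.ofReal_ofNat] <;> ring

lemma frame_image_unitSeg (u v : ℝ × ℝ) (h : u ≠ v) : frame u v h '' unitSeg = seg u v := by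
  ext q
  constructor
  · rintro ⟨_, ⟨t, ht, rfl⟩, rfl⟩
    exact ⟨(1 - t) / 2, (1 + t) / 2, by linarith [ht.2], by linarith [ht.1], by ring,
      (frame_ofReal u v h t).symm⟩
  · rintro ⟨a, b, ha, hb, hab, rfl⟩
    refine ⟨_, ⟨b - a, ⟨by linarith, by linarith⟩, rfl⟩, ?_⟩
    simp only [frame_ofReal]
    congr 2 <;> linarith

lemma exists_two_sides {u v : ℝ × ℝ} (h : u ≠ v) {c : Set (ℝ × ℝ)} (hcc : IsClosed c)
    (hc : IsPreconnected c) (hu : u ∈ c) (hv : v ∈ c) (hcuv : c ∩ seg u v ⊆ {u, v}) :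
    ∃ W₁ W₂, IsSide c (seg u v) W₁ ∧ IsSide c (seg u v) W₂ ∧ Disjoint W₁ W₂ := by
  set f := frame u v h with hf
  have f1 : f 1 = v := by
    have := frame_ofReal u v h 1
    simpa using this
  have fm1 : f (-1) = u := by
    have := frame_ofReal u v h (-1)
    norm_num at this
    simpa using this
  obtain ⟨W₁, W₂, s1, s2, hd⟩ := exists_two_sides_unitSeg (c := f.symm '' c)
    (f.symm.isClosedMap _ hcc) (hc.image _ f.symm.continuous.continuousOn)
    ⟨v, hv, by rw [← f1, f.symm_apply_apply]⟩ ⟨u, hu, by rw [← fm1, f.symm_apply_apply]⟩ (by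
      rintro t ht ⟨q, hq, hqt⟩
      have hqf : q = f t := by rw [← hqt, f.apply_symm_apply]
      have hqs : q ∈ seg u v := by
        rw [← frame_image_unitSeg u v h, hqf]
        exact mem_image_of_mem _ ⟨t, ⟨(abs_lt.1 ht).1.le, (abs_lt.1 ht).2.le⟩, rfl⟩
      rcases hcuv ⟨hq, hqs⟩ with e | e
      · rw [hqf, ← fm1] at e
        have := f.injective e
        have h2 : t = -1 := by exact_mod_cast this
        rw [h2] at ht; norm_num at ht
      · rw [hqf, mem_singleton_iff, ← f1] at e
        have := f.injective e
        have h2 : t = 1 := by exact_mod_cast this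
        rw [h2] at ht; norm_num at ht)
  have t1 := s1.image f
  have t2 := s2.image f
  have e : f '' (f.symm '' c) = c := f.toEquiv.image_symm_image c
  rw [e, frame_image_unitSeg] at t1 t2
  exact ⟨_, _, t1, t2, (disjoint_image_iff f.injective).2 hd⟩

/-- The drawing of the part of `H` spanned by the vertices in `S`. -/
def draw {V : Type} (pos : V → ℝ × ℝ) (S : Set V) (H : SimpleGraph V) : Set (ℝ × ℝ) :=
  pos '' S ∪ {p | ∃ a ∈ S, ∃ b ∈ S, H.Adj a b ∧ p ∈ seg (pos a) (pos b)}

lemma draw_mono {V : Type} {pos : V → ℝ × ℝ} {S T : Set V} {H K : SimpleGraph V} (hS : S ⊆ T)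
    (hH : H ≤ K) : draw pos S H ⊆ draw pos T K := by
  rintro p (⟨a, ha, rfl⟩ | ⟨a, ha, b, hb, hab, hp⟩)
  · exact Or.inl ⟨a, hS ha, rfl⟩
  · exact Or.inr ⟨a, hS ha, b, hS hb, hH hab, hp⟩

lemma isCompact_seg (x y : ℝ × ℝ) : IsCompact (seg x y) := by
  unfold seg
  rw [segment_eq_image_lineMap]
  exact isCompact_Icc.image AffineMap.lineMap_continuous

lemma isCompact_draw {V : Type} [Finite V] (pos : V → ℝ × ℝ) (S : Set V) (H : SimpleGraph V) :
    IsCompact (draw pos S H) := by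
  refine ((toFinite S).image pos).isCompact.union ?_
  have : {p | ∃ a ∈ S, ∃ b ∈ S, H.Adj a b ∧ p ∈ seg (pos a) (pos b)} =
      ⋃ e ∈ {e : V × V | e.1 ∈ S ∧ e.2 ∈ S ∧ H.Adj e.1 e.2}, seg (pos e.1) (pos e.2) := by
    ext p
    simp only [mem_ofPred_eq, mem_iUnion, exists_prop, Prod.exists]
    tauto
  rw [this]
  exact (toFinite _).isCompact_biUnion fun e _ => isCompact_seg _ _

lemma draw_univ {V : Type} {G : SimpleGraph V} (E : PlaneEmb G) :
    draw E.pos univ G = E.drawing := by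
  ext p
  simp [draw, PlaneEmb.drawing]

lemma mem_draw_of_mem {V : Type} {pos : V → ℝ × ℝ} {S : Set V} {H : SimpleGraph V} {a : V}
    (ha : a ∈ S) : pos a ∈ draw pos S H := Or.inl ⟨a, ha, rfl⟩

lemma seg_subset_draw {V : Type} {pos : V → ℝ × ℝ} {S : Set V} {H : SimpleGraph V} {a b : V}
    (ha : a ∈ S) (hb : b ∈ S) (hab : H.Adj a b) : seg (pos a) (pos b) ⊆ draw pos S H :=
  fun _ hp => Or.inr ⟨a, ha, b, hb, hab, hp⟩

lemma left_mem_seg (x y : ℝ × ℝ) : x ∈ seg x y := left_mem_segment ℝ x y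

lemma right_mem_seg (x y : ℝ × ℝ) : y ∈ seg x y := right_mem_segment ℝ x y

lemma seg_comm (x y : ℝ × ℝ) : seg x y = seg y x := segment_symm ℝ x y

lemma isPreconnected_seg (x y : ℝ × ℝ) : IsPreconnected (seg x y) :=
  (convex_segment x y).isPreconnected

lemma isPreconnected_seg_diff_right (x y : ℝ × ℝ) : IsPreconnected (seg x y \ {y}) := by
  rcases eq_or_ne x y with rfl | hxy
  · have : seg x x \ {x} = ∅ := by simp [seg]
    rw [this]; exact isPreconnected_empty
  have : seg x y \ {y} = AffineMap.lineMap x y '' Ico (0 : ℝ) 1 := by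
    unfold seg
    rw [segment_eq_image_lineMap]
    ext p
    constructor
    · rintro ⟨⟨t, ht, rfl⟩, hp⟩
      refine ⟨t, ⟨ht.1, lt_of_le_of_ne ht.2 ?_⟩, rfl⟩
      rintro rfl; exact hp (by simp)
    · rintro ⟨t, ht, rfl⟩
      refine ⟨⟨t, ⟨ht.1, ht.2.le⟩, rfl⟩, ?_⟩
      intro h
      have h2 : AffineMap.lineMap x y t = AffineMap.lineMap x y (1 : ℝ) := by simpa using h
      exact ht.2.ne (AffineMap.lineMap_injective ℝ hxy h2)
  rw [this]
  exact isPreconnected_Ico.image _ AffineMap.lineMap_continuous.continuousOn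

section Chord

variable {V : Type} [Finite V] {G : SimpleGraph V}

/-- Near a vertex the drawing is a cone, so a vertex in the closure of the outer face is
the end of a segment whose interior lies in the outer face. -/
lemma exists_access_segment (E : PlaneEmb G) {u : V}
    (hu : E.pos u ∈ closure (outer E.drawing)) :
    ∃ q ∈ outer E.drawing, seg q (E.pos u) \ {E.pos u} ⊆ outer E.drawing := by
  set X : Set (ℝ × ℝ) := E.pos '' {u}ᶜ ∪
    {p | ∃ a ∈ ({u}ᶜ : Set V), ∃ b ∈ ({u}ᶜ : Set V), G.Adj a b ∧ p ∈ seg (E.pos a) (E.pos b)}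
    with hX
  have hXc : IsCompact X := isCompact_draw E.pos {u}ᶜ G
  have huX : E.pos u ∉ X := by
    rintro (⟨a, ha, hau⟩ | ⟨a, ha, b, hb, hab, hp⟩)
    · exact ha (E.inj hau)
    · exact E.vertex_off hab (Ne.symm ha) (Ne.symm hb) hp
  obtain ⟨r, hr, hball⟩ := Metric.mem_nhds_iff.1 (hXc.isClosed.isOpen_compl.mem_nhds huX)
  obtain ⟨q, hq, hqr⟩ := Metric.mem_closure_iff.1 hu r hr
  rw [dist_comm] at hqr
  have hqu : q ≠ E.pos u := by
    rintro rfl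
    exact hq.1 (by rw [← draw_univ]; exact mem_draw_of_mem (mem_univ u))
  have hdr : Bornology.IsBounded E.drawing := by
    rw [← draw_univ]; exact (isCompact_draw E.pos univ G).isBounded
  refine ⟨q, hq, subset_outer (isPreconnected_seg_diff_right _ _) ?_
    ⟨q, ⟨left_mem_seg _ _, hqu⟩, hq⟩⟩
  refine disjoint_left.2 ?_
  rintro p ⟨hp, hpu⟩ hpD
  rw [← draw_univ] at hpD
  have hp' := hp
  unfold seg at hp
  rw [segment_symm, segment_eq_image'] at hp
  obtain ⟨t, ht, rfl⟩ := hp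
  have ht0 : 0 < t := lt_of_le_of_ne ht.1 (by rintro rfl; exact hpu (by simp))
  have hpr : dist (E.pos u + t • (q - E.pos u)) (E.pos u) < r := by
    rw [dist_eq_norm, add_sub_cancel_left, norm_smul, Real.norm_of_nonneg ht.1, ← dist_eq_norm]
    nlinarith [ht.2, dist_nonneg (x := q) (y := E.pos u)]
  have hpX := hball hpr
  have key : ∀ w, G.Adj u w → E.pos u + t • (q - E.pos u) ∉ seg (E.pos u) (E.pos w) := by
    intro w huw hs
    unfold seg at hs
    rw [segment_eq_image'] at hs
    obtain ⟨s, hs, hst⟩ := hs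
    have hst : s • (E.pos w - E.pos u) = t • (q - E.pos u) := add_left_cancel hst
    have hwr : r ≤ dist (E.pos w) (E.pos u) := by
      by_contra! h
      exact hball h (Or.inl ⟨w, huw.ne', rfl⟩)
    have hn := congrArg norm hst
    rw [norm_smul, norm_smul, Real.norm_of_nonneg ht.1, Real.norm_of_nonneg hs.1,
      ← dist_eq_norm, ← dist_eq_norm] at hn
    have hst' : s ≤ t := by
      by_contra! h
      have h1 : t * dist q (E.pos u) < t * r := mul_lt_mul_of_pos_left hqr ht0
      have h2 : t * r ≤ s * dist (E.pos w) (E.pos u) :=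
        mul_le_mul h.le hwr hr.le hs.1
      linarith
    refine hq.1 ?_
    rw [← draw_univ]
    refine seg_subset_draw (mem_univ u) (mem_univ w) huw ?_
    unfold seg
    rw [segment_eq_image']
    refine ⟨s / t, ⟨div_nonneg hs.1 ht.1, (div_le_one ht0).2 hst'⟩, ?_⟩
    have : (s / t) • (E.pos w - E.pos u) = q - E.pos u := by
      rw [div_eq_inv_mul, mul_smul, hst, smul_smul, inv_mul_cancel₀ ht0.ne', one_smul]
    simp [this]
  rcases hpD with ⟨a, -, ha⟩ | ⟨a, -, b, -, hab, hp⟩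
  · by_cases hau : a = u
    · subst hau; exact hpu ha.symm
    · exact hpX (Or.inl ⟨a, hau, ha⟩)
  · by_cases hau : a = u
    · subst hau; exact key b hab hp
    · by_cases hbu : b = u
      · subst hbu; rw [seg_comm] at hp; exact key a hab.symm hp
      · exact hpX (Or.inr ⟨a, hau, b, hbu, hab, hp⟩)

/-- Two vertices on the outer face are joined by an arc inside the outer face. -/
lemma exists_crosscut (E : PlaneEmb G) {u v : V}
    (hu : E.pos u ∈ closure (outer E.drawing)) (hv : E.pos v ∈ closure (outer E.drawing)) :
    ∃ c : Set (ℝ × ℝ), IsCompact c ∧ IsPreconnected c ∧ E.pos u ∈ c ∧ E.pos v ∈ c ∧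
      c ⊆ outer E.drawing ∪ {E.pos u, E.pos v} ∧ (c ∩ outer E.drawing).Nonempty := by
  obtain ⟨q, hq, hqF⟩ := exists_access_segment E hu
  obtain ⟨q', hq', hqF'⟩ := exists_access_segment E hv
  have hc : IsCompact E.drawing := by rw [← draw_univ]; exact isCompact_draw E.pos univ G
  have hconn : IsConnected (outer E.drawing) :=
    ⟨⟨q, hq⟩, isPreconnected_outer hc.isBounded⟩
  have hpath := (isOpen_outer hc).isConnected_iff_isPathConnected.1 hconn
  obtain ⟨γ, hγ⟩ := hpath.joinedIn q hq q' hq'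
  have hr : IsPreconnected (range γ) := isPreconnected_range γ.continuous
  have m0 : q ∈ range γ := ⟨0, γ.source⟩
  have m1 : q' ∈ range γ := ⟨1, γ.target⟩
  refine ⟨seg q (E.pos u) ∪ range γ ∪ seg q' (E.pos v),
    ((isCompact_seg _ _).union (isCompact_range γ.continuous)).union (isCompact_seg _ _),
    ?_, Or.inl (Or.inl (right_mem_seg _ _)), Or.inr (right_mem_seg _ _), ?_,
    ⟨q, Or.inl (Or.inr m0), hq⟩⟩
  · exact (IsPreconnected.union q (left_mem_seg _ _) m0 (isPreconnected_seg _ _) hr).union q'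
      (Or.inr m1) (left_mem_seg _ _) (isPreconnected_seg _ _)
  · rintro p ((hp | ⟨t, rfl⟩) | hp)
    · by_cases h : p = E.pos u
      · exact Or.inr (Or.inl h)
      · exact Or.inl (hqF ⟨hp, h⟩)
    · exact Or.inl (hγ t)
    · by_cases h : p = E.pos v
      · exact Or.inr (Or.inr h)
      · exact Or.inl (hqF' ⟨hp, h⟩)

lemma seg_subset_closure_outer {u v : ℝ × ℝ} {c D D' W : Set (ℝ × ℝ)} (hD : IsCompact D)
    (hD' : D' ⊆ D) (hcF : c ⊆ outer D ∪ {u, v}) (hne : (c ∩ outer D).Nonempty)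
    (huv : seg u v ⊆ D) (hcc : IsClosed c)
    (hW : IsSide c (seg u v) W) (hdis : Disjoint W D') : seg u v ⊆ closure (outer D') := by
  have hF : outer D ⊆ outer D' := outer_anti hD'
  have hWF : (W ∩ outer D).Nonempty := by
    by_contra hWF
    have hWF' : Disjoint W (outer D) := disjoint_iff_inter_eq_empty.2 (not_nonempty_iff_eq_empty.1 hWF)
    have hcl : closure W ⊆ W ∪ seg u v := by
      intro y hy
      by_contra hy'
      rw [mem_union, not_or] at hy'
      by_cases hyc : y ∈ c
      · rcases hcF hyc with h | h | h
        · exact disjoint_left.1 ((hWF'.symm.closure_right (isOpen_outer hD))) h hy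
        · subst h; exact hy'.2 (left_mem_seg _ _)
        · rw [mem_singleton_iff] at h; subst h; exact hy'.2 (right_mem_seg _ _)
      · have hcl : IsClosed (c ∪ seg u v) := hcc.union (isCompact_seg _ _).isClosed
        have hyU : y ∈ (c ∪ seg u v)ᶜ := fun h => h.elim hyc hy'.2
        obtain ⟨r, hr, hball⟩ := Metric.mem_nhds_iff.1 (hcl.isOpen_compl.mem_nhds hyU)
        obtain ⟨z, hz, hzr⟩ := Metric.mem_closure_iff.1 hy r hr
        refine hy'.1 (hW.maximal (Metric.ball y r) (convex_ball y r).isPreconnected ?_ ?_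
          (Metric.mem_ball_self hr))
        · exact disjoint_left.2 fun p hp hp' => hball hp hp'
        · exact ⟨z, by rw [Metric.mem_ball, dist_comm]; exact hzr, hz⟩
    have hconn := (convex_segment u v).isPreconnected_compl_of_isCompact (isCompact_seg u v)
    obtain ⟨q, hqc, hqF⟩ := hne
    obtain ⟨w, hw⟩ : W.Nonempty := by
      rw [← closure_nonempty_iff]; exact ⟨u, hW.subset_closure (left_mem_seg _ _)⟩
    have hsub : (segment ℝ u v)ᶜ ⊆ W := by
      refine hconn.subset_of_closure_inter_subset hW.isOpen
        ⟨w, fun h => disjoint_left.1 hW.disjoint hw (Or.inr h), hw⟩ ?_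
      rintro y ⟨hy, hys⟩
      exact (hcl hy).resolve_right hys
    exact disjoint_left.1 hWF' (hsub fun h => hqF.1 (huv h)) hqF
  have hWo : W ⊆ outer D' := subset_outer hW.isPreconnected hdis (hWF.mono
    (inter_subset_inter_right _ hF))
  exact hW.subset_closure.trans (closure_mono hWo)

/-- A chord of the outer face splits the remaining vertices into two parts with no edges between
them, so that the chord is on the outer boundary of either part. -/
lemma exists_chord_split (E : PlaneEmb G) {u v : V} (huv : G.Adj u v)
    (hu : E.pos u ∈ closure (outer E.drawing)) (hv : E.pos v ∈ closure (outer E.drawing)) :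
    ∃ A B : Set V, (∀ w, w ∈ A ∨ w ∈ B ↔ w ≠ u ∧ w ≠ v) ∧ Disjoint A B ∧
      (∀ a ∈ A, ∀ b ∈ B, ¬ G.Adj a b) ∧
      seg (E.pos u) (E.pos v) ⊆ closure (outer (draw E.pos (insert u (insert v A)) G)) ∧
      seg (E.pos u) (E.pos v) ⊆ closure (outer (draw E.pos (insert u (insert v B)) G)) := by
  have hD : IsCompact E.drawing := by rw [← draw_univ]; exact isCompact_draw E.pos univ G
  obtain ⟨c, hcK, hcP, huc, hvc, hcF, hcne⟩ := exists_crosscut E hu hv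
  have hcD : ∀ p ∈ c, p ∈ E.drawing → p = E.pos u ∨ p = E.pos v := fun p hp hpD =>
    (hcF hp).elim (fun h => absurd hpD h.1) id
  have hsegD : ∀ {a b : V}, G.Adj a b → seg (E.pos a) (E.pos b) ⊆ E.drawing := by
    intro a b hab
    rw [← draw_univ]; exact seg_subset_draw (mem_univ _) (mem_univ _) hab
  obtain ⟨W₁, W₂, s1, s2, hdis⟩ := exists_two_sides (E.inj.ne huv.ne) hcK.isClosed hcP huc hvc
    (fun p hp => hcD p hp.1 (hsegD huv hp.2))
  have hedge : ∀ a b, G.Adj a b → a ≠ u → a ≠ v →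
      IsPreconnected (seg (E.pos a) (E.pos b) \ {E.pos u, E.pos v}) ∧
      Disjoint (seg (E.pos a) (E.pos b) \ {E.pos u, E.pos v})
        (c ∪ seg (E.pos u) (E.pos v)) ∧
      E.pos a ∈ seg (E.pos a) (E.pos b) \ {E.pos u, E.pos v} := by
    intro a b hab hau hav
    refine ⟨?_, ?_, left_mem_seg _ _, ?_⟩
    · by_cases hb : b = u ∨ b = v
      · have : seg (E.pos a) (E.pos b) \ {E.pos u, E.pos v} =
            seg (E.pos a) (E.pos b) \ {E.pos b} := by
          ext p
          constructor
          · rintro ⟨hp, hp2⟩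
            exact ⟨hp, fun h => hp2 (by rcases hb with rfl | rfl; exacts [Or.inl h, Or.inr h])⟩
          · rintro ⟨hp, hp2⟩
            refine ⟨hp, ?_⟩
            rintro (h | h) <;> rcases hb with rfl | rfl
            · exact hp2 h
            · exact E.vertex_off hab (Ne.symm hau) huv.ne (h ▸ hp)
            · rw [mem_singleton_iff] at h
              exact E.vertex_off hab (Ne.symm hav) huv.ne' (h ▸ hp)
            · exact hp2 h
        rw [this]; exact isPreconnected_seg_diff_right _ _
      · push Not at hb
        have : seg (E.pos a) (E.pos b) \ {E.pos u, E.pos v} = seg (E.pos a) (E.pos b) := by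
          refine sdiff_eq_left.2 (disjoint_left.2 ?_)
          rintro p hp (h | h)
          · exact E.vertex_off hab (Ne.symm hau) (Ne.symm hb.1) (h ▸ hp)
          · rw [mem_singleton_iff] at h
            exact E.vertex_off hab (Ne.symm hav) (Ne.symm hb.2) (h ▸ hp)
        rw [this]; exact isPreconnected_seg _ _
    · refine disjoint_left.2 ?_
      rintro p ⟨hp, hp2⟩ (h | h)
      · exact hp2 (hcD p h (hsegD hab hp))
      · refine hp2 (E.edges_meet huv hab ?_ ⟨h, hp⟩).1
        rw [Ne, Sym2.eq_iff]
        rintro (⟨h1, -⟩ | ⟨-, h1⟩)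
        · exact hau h1.symm
        · exact hav h1.symm
    · rintro (h | h)
      · exact hau (E.inj h)
      · exact hav (E.inj h)
  have hin : ∀ W, IsSide c (seg (E.pos u) (E.pos v)) W → ∀ a b, G.Adj a b → a ≠ u → a ≠ v →
      E.pos a ∈ W → seg (E.pos a) (E.pos b) \ {E.pos u, E.pos v} ⊆ W := by
    intro W hW a b hab hau hav haW
    obtain ⟨h1, h2, h3⟩ := hedge a b hab hau hav
    exact hW.maximal _ h1 h2 ⟨_, h3, haW⟩
  have hout : ∀ W, IsSide c (seg (E.pos u) (E.pos v)) W → ∀ a b, G.Adj a b → a ≠ u → a ≠ v →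
      E.pos a ∉ W → ∀ p ∈ seg (E.pos a) (E.pos b), p ∉ W := by
    intro W hW a b hab hau hav haW p hp hpW
    obtain ⟨h1, h2, h3⟩ := hedge a b hab hau hav
    refine haW (hW.maximal _ h1 h2 ⟨p, ⟨hp, ?_⟩, hpW⟩ h3)
    rintro (h | h)
    · exact disjoint_left.1 hW.disjoint hpW (Or.inl (h ▸ huc))
    · rw [mem_singleton_iff] at h
      exact disjoint_left.1 hW.disjoint hpW (Or.inl (h ▸ hvc))
  have hfin : ∀ W, IsSide c (seg (E.pos u) (E.pos v)) W → ∀ S : Set V,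
      (∀ a ∈ S, a ≠ u → a ≠ v → E.pos a ∉ W) →
      seg (E.pos u) (E.pos v) ⊆ closure (outer (draw E.pos (insert u (insert v S)) G)) := by
    intro W hW S hS
    have hS' : ∀ a ∈ insert u (insert v S), E.pos a ∉ W := by
      intro a ha haW
      by_cases hau : a = u
      · subst hau; exact disjoint_left.1 hW.disjoint haW (Or.inl huc)
      by_cases hav : a = v
      · subst hav; exact disjoint_left.1 hW.disjoint haW (Or.inl hvc)
      exact hS a ((ha.resolve_left hau).resolve_left hav) hau hav haW
    refine seg_subset_closure_outer hD (by rw [← draw_univ]; exact draw_mono (subset_univ _) le_rfl)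
      hcF hcne (hsegD huv) hcK.isClosed hW (disjoint_left.2 ?_)
    rintro p hpW (⟨a, ha, rfl⟩ | ⟨a, ha, b, hb, hab, hp⟩)
    · exact hS' a ha hpW
    · by_cases ha2 : a ≠ u ∧ a ≠ v
      · exact hout W hW a b hab ha2.1 ha2.2 (hS' a ha) p hp hpW
      · by_cases hb2 : b ≠ u ∧ b ≠ v
        · rw [seg_comm] at hp
          exact hout W hW b a hab.symm hb2.1 hb2.2 (hS' b hb) p hp hpW
        · have ha3 : a = u ∨ a = v := by tauto
          have hb3 : b = u ∨ b = v := by tauto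
          have : p ∈ seg (E.pos u) (E.pos v) := by
            rcases ha3 with rfl | rfl <;> rcases hb3 with rfl | rfl
            · exact absurd rfl hab.ne
            · exact hp
            · rwa [seg_comm]
            · exact absurd rfl hab.ne
          exact disjoint_left.1 hW.disjoint hpW (Or.inr this)
  refine ⟨{w | E.pos w ∈ W₁}, {w | w ≠ u ∧ w ≠ v ∧ E.pos w ∉ W₁}, ?_, ?_, ?_, ?_, ?_⟩
  · intro w
    constructor
    · rintro (h | h)
      · refine ⟨?_, ?_⟩ <;> rintro rfl
        · exact disjoint_left.1 s1.disjoint h (Or.inl huc)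
        · exact disjoint_left.1 s1.disjoint h (Or.inl hvc)
      · exact ⟨h.1, h.2.1⟩
    · intro h
      by_cases hw : E.pos w ∈ W₁
      · exact Or.inl hw
      · exact Or.inr ⟨h.1, h.2, hw⟩
  · exact disjoint_left.2 fun w h h' => h'.2.2 h
  · rintro a ha b ⟨hbu, hbv, hb⟩ hab
    exact hout W₁ s1 b a hab.symm hbu hbv hb (E.pos a) (right_mem_seg _ _) ha
  · exact hfin W₂ s2 _ fun a ha _ _ h => disjoint_left.1 hdis ha h
  · exact hfin W₁ s1 _ fun a ha _ _ h => ha.2.2 h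

end Chord

lemma PlaneEmb.isCompact_drawing [Finite V] (E : PlaneEmb G) : IsCompact E.drawing :=
  draw_univ E ▸ isCompact_draw _ _ _

lemma PlaneEmb.IsOuterFace.eq_outer [Finite V] {E : PlaneEmb G} {F : Set (ℝ × ℝ)}
    (hF : E.IsOuterFace F) : F = outer E.drawing := by
  obtain ⟨⟨q, hq, rfl⟩, hb⟩ := hF
  exact connectedComponentIn_eq_outer E.isCompact_drawing.isBounded ⟨hq, hb⟩

lemma HasCycleLen.of_comap {W : Type} {H : SimpleGraph V} {f : W → V}
    (hf : Function.Injective f) (hH : H ≤ G) {k : ℕ} (h : HasCycleLen (H.comap f) k) :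
    HasCycleLen G k := by
  obtain ⟨v, c, hc, rfl⟩ := h
  let g : H.comap f →g G := ⟨f, fun h => hH h⟩
  exact ⟨f v, c.map g, hc.map (f := g) hf, by simp⟩

/-- The embedding induced on the graph pulled back along an injection. -/
def PlaneEmb.comap {W : Type} (E : PlaneEmb G) {H : SimpleGraph V} (hH : H ≤ G) {f : W → V}
    (hf : Function.Injective f) : PlaneEmb (H.comap f) where
  pos := E.pos ∘ f
  inj := E.inj.comp hf
  edges_meet a b c d hab hcd hne := by
    refine E.edges_meet (hH hab) (hH hcd) fun h => hne ?_
    exact Sym2.map.injective hf (by simpa using h)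
  vertex_off a b v hab ha hb := E.vertex_off (hH hab) (hf.ne ha) (hf.ne hb)

lemma PlaneEmb.drawing_comap {W : Type} (E : PlaneEmb G) {H : SimpleGraph V} (hH : H ≤ G)
    {f : W → V} (hf : Function.Injective f) :
    (E.comap hH hf).drawing = draw E.pos (range f) H := by
  rw [← draw_univ]
  ext p
  simp [draw, PlaneEmb.comap]

lemma exists_fin_range_eq {n : ℕ} (S : Set (Fin n)) :
    ∃ (k : ℕ) (f : Fin k → Fin n), Function.Injective f ∧ range f = S := by
  have e := (Finite.equivFin S).symm
  refine ⟨_, fun i => (e i).1, Subtype.val_injective.comp e.injective, ?_⟩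
  have := e.surjective.range_comp (Subtype.val : S → Fin n)
  rw [Subtype.range_val] at this
  exact this

lemma card_edgeSet_comap_le {W : Type} [Finite V] {H : SimpleGraph V} (hH : H ≤ G) {f : W → V}
    (hf : Function.Injective f) : Nat.card (H.comap f).edgeSet ≤ Nat.card G.edgeSet := by
  have hmem : ∀ e ∈ (H.comap f).edgeSet, Sym2.map f e ∈ G.edgeSet := by
    intro e
    induction e with
    | _ a b => exact fun h => hH h
  refine Nat.card_le_card_of_injective
    (fun e : (H.comap f).edgeSet => (⟨Sym2.map f e.1, hmem _ e.2⟩ : G.edgeSet)) fun a b h => ?_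
  exact Subtype.ext (Sym2.map.injective hf (congrArg Subtype.val h))

lemma card_edgeSet_lt [Finite V] {H : SimpleGraph V} (hH : H < G) :
    Nat.card H.edgeSet < Nat.card G.edgeSet := by
  rw [Nat.card_coe_set_eq, Nat.card_coe_set_eq]
  exact ncard_lt_ncard (SimpleGraph.edgeSet_ssubset_edgeSet.2 hH) (toFinite _)

namespace Cfg4

variable {C : Cfg4}

lemma closure_subset (hC : C.Valid) {S : Set (Fin C.n)} {H : SimpleGraph (Fin C.n)}
    (hH : H ≤ C.G) : closure C.F ⊆ closure (outer (draw C.E.pos S H)) := by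
  refine closure_mono ?_
  rw [hC.2.1.eq_outer, ← draw_univ]
  exact outer_anti (draw_mono (subset_univ _) hH)

open Classical in
/-- Smaller configurations inside a minimum counterexample are colorable: a precoloring of a
path on the outer face of a subgraph extends to the subgraph. -/
theorem MinCounterexample.exists_coloring (hC : C.MinCounterexample) {S : Set (Fin C.n)}
    {H : SimpleGraph (Fin C.n)} (hH : H ≤ C.G) {P : List (Fin C.n)} {ψ : Fin C.n → ℕ}
    (hlt : S ≠ univ ∨ H ≠ C.G ∨ ∃ p ∈ P, 2 ≤ (C.L p).card)
    (hnd : P.Nodup) (hlen : P.length ≤ 3) (hPS : ∀ p ∈ P, p ∈ S)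
    (hPF : ∀ p ∈ P, C.E.pos p ∈ closure (outer (draw C.E.pos S H)))
    (hch : P.IsChain fun a b => H.Adj a b ∧
      seg (C.E.pos a) (C.E.pos b) ⊆ closure (outer (draw C.E.pos S H)))
    (hψ : ∀ p ∈ P, ψ p ∈ C.L p)
    (hψ' : ∀ p ∈ P, ∀ q ∈ P, H.Adj p q → ψ p ≠ ψ q)
    (hold : ∀ v ∈ S, v ∈ C.P → v ∈ P)
    (hvi : ∀ x ∈ S, x ∉ P → (C.L x).card = 2 → ∀ p ∈ P, ∀ q ∈ P, p ≠ q →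
      H.Adj x p → H.Adj x q → False) :
    ∃ φ : Fin C.n → ℕ, (∀ v ∈ S, φ v ∈ C.L v) ∧ (∀ p ∈ P, φ p = ψ p) ∧
      ∀ a ∈ S, ∀ b ∈ S, H.Adj a b → φ a ≠ φ b := by
  have hval := hC.1
  obtain ⟨⟨h4, hF, -, -, -, -, h1, h8, h9, h10, h11, h12, -, -⟩, hnc, hmin⟩ := hC
  have hcl : ∀ v, v ∉ P → C.E.pos v ∉ closure (outer (draw C.E.pos S H)) → 3 ≤ (C.L v).card := 
    fun v _ hv => h9 v fun h => hv (closure_subset hval hH h)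
  obtain ⟨k, f, hf, rfl⟩ := exists_fin_range_eq S
  obtain ⟨Q, rfl⟩ : P ∈ range (List.map f) := by
    rw [range_list_map]; exact hPS
  set L' : Fin C.n → Finset ℕ := fun v => if v ∈ Q.map f then {ψ v} else C.L v with hL'
  have hL'P : ∀ v ∈ Q.map f, L' v = {ψ v} := fun v hv => by simp only [hL', if_pos hv]
  have hL'n : ∀ v ∉ Q.map f, L' v = C.L v := fun v hv => by simp only [hL', if_neg hv]
  have hmemQ : ∀ i, f i ∈ Q.map f ↔ i ∈ Q := fun i => List.mem_map_of_injective hf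
  have hL's : ∀ v, L' v ⊆ C.L v := by
    intro v
    by_cases hv : v ∈ Q.map f
    · rw [hL'P v hv]; simpa using hψ v hv
    · rw [hL'n v hv]
  let D : Cfg4 :=
    { n := k
      G := H.comap f
      E := C.E.comap hH hf
      F := outer (draw C.E.pos (range f) H)
      P := Q
      L := fun i => L' (f i) }
  have hdr : D.E.drawing = draw C.E.pos (range f) H := C.E.drawing_comap hH hf
  have hbd : Bornology.IsBounded (draw C.E.pos (range f) H) := (isCompact_draw _ _ _).isBounded
  have hDv : D.Valid := by
    refine ⟨fun h => h4 (h.of_comap hf hH), ?_, hnd.of_map f, by simpa using hlen,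
      fun v hv => hPF _ ((hmemQ v).2 hv), (List.isChain_map f).1 hch, fun v => ?_,
      fun u v huv => ?_, fun v hv => ?_, fun v hv hvP => ?_, fun v hv => ?_, fun u v huv hu => ?_,
      ⟨fun i => ψ (f i), fun v hv => ?_, fun u v hu hv huv => ?_⟩, fun x hx u hu v hv huv hxu hxv => ?_⟩
    · obtain ⟨q, hq⟩ := exists_mem_outer hbd
      refine ⟨⟨q, ?_, ?_⟩, not_isBounded_outer hbd⟩
      · rw [hdr]; exact hq.1
      · rw [hdr]; exact (connectedComponentIn_eq_outer hbd hq).symm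
    · show 1 ≤ (L' (f v)).card
      by_cases hv : f v ∈ Q.map f
      · simp [hL'P _ hv]
      · rw [hL'n _ hv]; exact h1 _
    · exact (Finset.card_le_card (Finset.inter_subset_inter (hL's _) (hL's _))).trans (h8 (hH huv))
    · show 3 ≤ (L' (f v)).card
      have hvP : f v ∉ Q.map f := fun h => hv (hPF _ h)
      rw [hL'n _ hvP]
      exact hcl _ hvP hv
    · show 2 ≤ (L' (f v)).card
      have hvP' : f v ∉ Q.map f := fun h => hvP ((hmemQ v).1 h)
      rw [hL'n _ hvP']
      by_cases hvF : f v ∈ C.E.onFace C.F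
      · exact h10 _ hvF fun h => hvP' (hold _ ⟨v, rfl⟩ h)
      · exact le_trans (by norm_num) (h9 _ hvF)
    · show (L' (f v)).card = 1
      simp [hL'P _ ((hmemQ v).2 hv)]
    · show (L' (f v)).card ≠ 2
      change (L' (f u)).card = 2 at hu
      by_cases hv : f v ∈ Q.map f
      · simp [hL'P _ hv]
      by_cases hu' : f u ∈ Q.map f
      · simp [hL'P _ hu'] at hu
      rw [hL'n _ hv]; rw [hL'n _ hu'] at hu
      exact h12 (hH huv) hu
    · show ψ (f v) ∈ L' (f v)
      simp [hL'P _ ((hmemQ v).2 hv)]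
    · exact hψ' _ ((hmemQ u).2 hu) _ ((hmemQ v).2 hv) huv
    · change (L' (f x)).card = 2 at hx
      by_cases hxP : f x ∈ Q.map f
      · simp [hL'P _ hxP] at hx
      rw [hL'n _ hxP] at hx
      exact hvi _ ⟨x, rfl⟩ hxP hx _ ((hmemQ u).2 hu) _ ((hmemQ v).2 hv) (hf.ne huv) hxu hxv
  have hDc : D.Colorable := by
    by_contra hDc
    obtain ⟨hm, hs⟩ := hmin D hDv hDc
    have hn : Nat.card (range f) ≤ C.n := by
      rw [Nat.card_coe_set_eq]
      simpa using ncard_le_ncard (subset_univ (range f)) (toFinite _)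
    have he : Nat.card D.G.edgeSet ≤ Nat.card C.G.edgeSet := card_edgeSet_comap_le hH hf
    have hn' : D.n = Nat.card (range f) := by
      rw [Nat.card_range_of_injective hf, Nat.card_fin]
    unfold Cfg4.measure at hm hs
    by_cases hS : range f = univ
    · have hneq : Nat.card (range f) = C.n := by rw [hS]; simp
      have hbij : Function.Bijective f := ⟨hf, range_eq_univ.1 hS⟩
      rcases hlt with h | hlt
      · exact h hS
      by_cases hHG : H = C.G
      · have hsum : D.listSum < C.listSum := by
          have : D.listSum = ∑ v, (L' v).card := hbij.sum_comp fun v => (L' v).card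
          rw [this]
          refine Finset.sum_lt_sum (fun v _ => Finset.card_le_card (hL's v)) ?_
          obtain ⟨p, hp, hp2⟩ := hlt.resolve_left (fun h => h hHG)
          refine ⟨p, Finset.mem_univ _, ?_⟩
          rw [hL'P _ hp, Finset.card_singleton]; omega
        have := hs (by omega)
        omega
      · have h1 := card_edgeSet_lt (lt_of_le_of_ne hH hHG)
        have h2 : Nat.card D.G.edgeSet ≤ Nat.card H.edgeSet := card_edgeSet_comap_le le_rfl hf
        omega
    · have : Nat.card (range f) < C.n := by
        rw [Nat.card_coe_set_eq]
        simpa using ncard_lt_ncard (ssubset_univ_iff.2 hS) (toFinite _)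
      omega
  obtain ⟨φ, hφ, hφ'⟩ := hDc
  refine ⟨Function.extend f φ 0, ?_, fun p hp => ?_, ?_⟩
  · rintro _ ⟨i, rfl⟩
    rw [hf.extend_apply]; exact hL's _ (hφ i)
  · obtain ⟨i, rfl⟩ := hPS p hp
    rw [hf.extend_apply]
    have : φ i ∈ L' (f i) := hφ i
    rw [hL'P _ hp] at this
    simpa using this
  · rintro _ ⟨i, rfl⟩ _ ⟨j, rfl⟩ hij
    rw [hf.extend_apply, hf.extend_apply]
    exact hφ' hij

end Cfg4

lemma not_adj_both {a b c d : V} (h4 : ¬ HasCycleLen G 4) (hab : G.Adj a b) (hbc : G.Adj b c)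
    (hcd : G.Adj c d) (hda : G.Adj d a) (hac : a ≠ c) (hbd : b ≠ d) : False := by
  refine h4 ⟨a, .cons hab (.cons hbc (.cons hcd (.cons hda .nil))), ?_, rfl⟩
  rw [SimpleGraph.Walk.cons_isCycle_iff]
  simp [hab.ne, hab.ne', hbc.ne, hcd.ne, hda.ne, hda.ne', hac, hac.symm, hbd]

namespace Cfg4

variable {C : Cfg4}

open Classical in
lemma false_of_glue (hC : ¬ C.Colorable) {S₁ S₂ : Set (Fin C.n)} {φ₁ φ₂ : Fin C.n → ℕ}
    (hS : ∀ v, v ∈ S₁ ∨ v ∈ S₂)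
    (hE : ∀ a b, C.G.Adj a b → a ∈ S₁ ∧ b ∈ S₁ ∨ a ∈ S₂ ∧ b ∈ S₂)
    (h₁ : ∀ v ∈ S₁, φ₁ v ∈ C.L v) (h₂ : ∀ v ∈ S₂, φ₂ v ∈ C.L v)
    (h₁' : ∀ a ∈ S₁, ∀ b ∈ S₁, C.G.Adj a b → φ₁ a ≠ φ₁ b)
    (h₂' : ∀ a ∈ S₂, ∀ b ∈ S₂, C.G.Adj a b → φ₂ a ≠ φ₂ b)
    (heq : ∀ v ∈ S₁, v ∈ S₂ → φ₂ v = φ₁ v) : False := by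
  have e₁ : ∀ v ∈ S₁, (if v ∈ S₁ then φ₁ v else φ₂ v) = φ₁ v := fun v hv => if_pos hv
  have e₂ : ∀ v ∈ S₂, (if v ∈ S₁ then φ₁ v else φ₂ v) = φ₂ v := fun v hv => by
    split_ifs with h
    · exact (heq v h hv).symm
    · rfl
  refine hC ⟨fun v => if v ∈ S₁ then φ₁ v else φ₂ v, fun v => ?_, fun a b hab => ?_⟩
  · rcases hS v with h | h
    · simpa only [e₁ v h] using h₁ v h
    · simpa only [e₂ v h] using h₂ v h
  · rcases hE a b hab with ⟨ha, hb⟩ | ⟨ha, hb⟩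
    · simpa only [e₁ a ha, e₁ b hb] using h₁' a ha b hb hab
    · simpa only [e₂ a ha, e₂ b hb] using h₂' a ha b hb hab

/-- Proper subconfigurations keeping the whole precolored path are colorable. -/
lemma MinCounterexample.exists_coloring_of_path_subset (hC : C.MinCounterexample)
    {S : Set (Fin C.n)} {H : SimpleGraph (Fin C.n)} (hH : H ≤ C.G) (hlt : S ≠ univ ∨ H ≠ C.G)
    (hPS : ∀ p ∈ C.P, p ∈ S) (hPH : ∀ p ∈ C.P, ∀ q ∈ C.P, C.G.Adj p q → H.Adj p q) :
    ∃ φ : Fin C.n → ℕ, (∀ v ∈ S, φ v ∈ C.L v) ∧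
      ∀ a ∈ S, ∀ b ∈ S, H.Adj a b → φ a ≠ φ b := by
  have hval := hC.1
  obtain ⟨-, -, hnd, hlen, hPF, hch, -, -, -, -, -, -, ⟨ψ, hψ, hψ'⟩, hvi⟩ := hC.1
  obtain ⟨φ, h1, -, h2⟩ := hC.exists_coloring hH (hlt.imp_right Or.inl) hnd hlen hPS
    (fun p hp => closure_subset hval hH (hPF p hp))
    (List.IsChain.imp_of_mem_imp (fun a b ha hb hab =>
      ⟨hPH a ha b hb hab.1, hab.2.trans (closure_subset hval hH)⟩) hch) hψ
    (fun p hp q hq hpq => hψ' hp hq (hH hpq)) (fun _ _ h => h)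
    (fun x _ _ hx p hp q hq hpq hxp hxq => hvi x hx p hp q hq hpq (hH hxp) (hH hxq))
  exact ⟨φ, h1, h2⟩

lemma MinCounterexample.exists_coloring_deleteEdge (hC : C.MinCounterexample) {y z : Fin C.n}
    (hyz : C.G.Adj y z) (hP : y ∉ C.P ∨ z ∉ C.P) :
    ∃ φ : Fin C.n → ℕ, (∀ v, φ v ∈ C.L v) ∧
      (∀ a b, C.G.Adj a b → s(a, b) ≠ s(y, z) → φ a ≠ φ b) ∧ φ y = φ z := by
  have hne : C.G.deleteEdges {s(y, z)} ≠ C.G := fun h => by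
    have := hyz
    rw [← h] at this
    simp at this
  obtain ⟨φ, h1, h2⟩ := hC.exists_coloring_of_path_subset (S := univ)
    (C.G.deleteEdges_le {s(y, z)}) (Or.inr hne) (fun _ _ => mem_univ _) (fun p hp q hq hpq => by
      refine (SimpleGraph.deleteEdges_adj ..).2 ⟨hpq, fun h => ?_⟩
      rcases Sym2.eq_iff.1 (mem_singleton_iff.1 h) with ⟨rfl, rfl⟩ | ⟨rfl, rfl⟩ <;> tauto)
  have h3 : ∀ a b, C.G.Adj a b → s(a, b) ≠ s(y, z) → φ a ≠ φ b := fun a b hab hne =>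
    h2 a (mem_univ _) b (mem_univ _) ((SimpleGraph.deleteEdges_adj ..).2 ⟨hab, by simpa using hne⟩)
  refine ⟨φ, fun v => h1 v (mem_univ v), h3, ?_⟩
  by_contra hφ
  refine hC.2.1 ⟨φ, fun v => h1 v (mem_univ v), fun a b hab => ?_⟩
  by_cases h : s(a, b) = s(y, z)
  · rcases Sym2.eq_iff.1 h with ⟨rfl, rfl⟩ | ⟨rfl, rfl⟩
    · exact hφ
    · exact fun h => hφ h.symm
  · exact h3 a b hab h

/-- No triangle has exactly one vertex on the precolored path. -/
lemma MinCounterexample.not_triangle (hC : C.MinCounterexample) {u x v : Fin C.n}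
    (hu : u ∈ C.P) (hx : x ∉ C.P) (hv : v ∉ C.P) (hux : C.G.Adj u x) (hxv : C.G.Adj x v)
    (huv : C.G.Adj u v) : False := by
  obtain ⟨-, -, -, -, -, -, -, h8, -, -, h11, -⟩ := hC.1
  obtain ⟨a, ha⟩ := Finset.card_eq_one.1 (h11 u hu)
  have hφu : ∀ φ : Fin C.n → ℕ, (∀ v, φ v ∈ C.L v) → φ u = a := fun φ h => by
    simpa [ha] using h u
  obtain ⟨φ, h1, h2, h3⟩ := hC.exists_coloring_deleteEdge hxv (Or.inl hx)
  obtain ⟨χ, g1, -, g3⟩ := hC.exists_coloring_deleteEdge hux (Or.inr hx)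
  obtain ⟨θ, t1, -, t3⟩ := hC.exists_coloring_deleteEdge huv (Or.inr hv)
  have hax : a ∈ C.L x := hφu χ g1 ▸ g3 ▸ g1 x
  have hav : a ∈ C.L v := hφu θ t1 ▸ t3 ▸ t1 v
  have hne : φ u ≠ φ x := h2 u x hux fun h => by
    rcases Sym2.eq_iff.1 h with ⟨h, -⟩ | ⟨h, -⟩
    · exact hx (h ▸ hu)
    · exact hv (h ▸ hu)
  rw [hφu φ h1] at hne
  exact hne (Finset.card_le_one.1 (h8 hxv) _ (Finset.mem_inter.2 ⟨hax, hav⟩) _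
    (Finset.mem_inter.2 ⟨h1 x, h3 ▸ h1 v⟩))

end Cfg4

lemma seg_subset_closure_compl_convexHull {a b : ℝ × ℝ} (hab : a ≠ b) (c : ℝ × ℝ) :
    seg a b ⊆ closure (convexHull ℝ {a, b, c})ᶜ := by
  intro p hp
  have key : ∀ w : ℝ × ℝ, 0 < w.1 * w.1 + w.2 * w.2 → w.1 * (a.1 - b.1) + w.2 * (a.2 - b.2) = 0 →
      w.1 * c.1 + w.2 * c.2 ≤ w.1 * a.1 + w.2 * a.2 → p ∈ closure (convexHull ℝ {a, b, c})ᶜ := by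
    intro w hw hwab hwc
    have hlin : IsLinearMap ℝ fun q : ℝ × ℝ => w.1 * q.1 + w.2 * q.2 :=
      ⟨fun x y => by simp; ring, fun r x => by simp; ring⟩
    have hsub : convexHull ℝ {a, b, c} ⊆ {q | w.1 * q.1 + w.2 * q.2 ≤ w.1 * a.1 + w.2 * a.2} := by
      refine convexHull_min ?_ (convex_halfSpace_le hlin _)
      rintro q (rfl | rfl | rfl)
      · rw [mem_ofPred_eq]
      · rw [mem_ofPred_eq]; linarith
      · exact hwc
    have hpa : w.1 * p.1 + w.2 * p.2 = w.1 * a.1 + w.2 * a.2 := by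
      obtain ⟨s, t, hs, ht, hst, rfl⟩ := hp
      simp only [Prod.fst_add, Prod.snd_add, Prod.smul_fst, Prod.smul_snd, smul_eq_mul]
      obtain rfl : s = 1 - t := by linarith
      linear_combination (-t) * hwab
    have hcont : Continuous fun t : ℝ => p + t • w := by fun_prop
    have h0 : (0 : ℝ) ∈ closure (Ioi 0) := by rw [closure_Ioi]; exact self_mem_Ici
    have := map_mem_closure hcont h0 (t := (convexHull ℝ {a, b, c})ᶜ) fun t ht hK => by
      have h1 := hsub hK
      simp only [mem_ofPred_eq, Prod.fst_add, Prod.snd_add, Prod.smul_fst, Prod.smul_snd,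
        smul_eq_mul] at h1
      have h2 := mul_pos (mem_Ioi.1 ht) hw
      linarith
    simpa using this
  have hpos : 0 < (a.2 - b.2) * (a.2 - b.2) + (b.1 - a.1) * (b.1 - a.1) := by
    by_contra! h
    refine hab (Prod.ext ?_ ?_) <;> nlinarith [sq_nonneg (a.2 - b.2), sq_nonneg (b.1 - a.1)]
  rcases le_total ((a.2 - b.2) * c.1 + (b.1 - a.1) * c.2) ((a.2 - b.2) * a.1 + (b.1 - a.1) * a.2)
    with h | h
  · exact key (a.2 - b.2, b.1 - a.1) hpos (by ring) h
  · exact key (-(a.2 - b.2), -(b.1 - a.1)) (by simpa only [neg_mul_neg] using hpos) (by ring)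
      (by linarith)

lemma isCompact_triBoundary (a b c : ℝ × ℝ) : IsCompact (triBoundary a b c) :=
  ((isCompact_seg a b).union (isCompact_seg b c)).union (isCompact_seg a c)

lemma closure_outer_subset {D : Set (ℝ × ℝ)} (hD : IsCompact D) :
    closure (outer D) ⊆ D ∪ outer D := by
  intro q hq
  by_contra h
  rw [mem_union, not_or] at h
  have hqD : q ∈ Dᶜ := h.1
  have hopen : IsOpen (connectedComponentIn Dᶜ q) := hD.isClosed.isOpen_compl.connectedComponentIn
  obtain ⟨y, hy, hyo⟩ := mem_closure_iff.1 hq _ hopen (mem_connectedComponentIn hqD)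
  exact h.2 (subset_outer isPreconnected_connectedComponentIn
    (disjoint_left.2 fun z hz hzD => connectedComponentIn_subset Dᶜ q hz hzD) ⟨y, hy, hyo⟩
    (mem_connectedComponentIn hqD))

lemma convexHull_triple_subset {a b c : ℝ × ℝ} {K : Set (ℝ × ℝ)} (hK : Convex ℝ K) (ha : a ∈ K)
    (hb : b ∈ K) (hc : c ∈ K) : triBoundary a b c ⊆ K :=
  union_subset (union_subset (hK.segment_subset ha hb) (hK.segment_subset hb hc))
    (hK.segment_subset ha hc)

lemma isCompact_convexHull_triple (a b c : ℝ × ℝ) : IsCompact (convexHull ℝ {a, b, c}) :=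
  (toFinite _).isCompact_convexHull ℝ

lemma triInterior_subset_convexHull (a b c : ℝ × ℝ) :
    triInterior a b c ⊆ convexHull ℝ {a, b, c} := by
  intro q hq
  by_contra hqK
  have hK := convex_convexHull ℝ ({a, b, c} : Set (ℝ × ℝ))
  have hs : triBoundary a b c ⊆ convexHull ℝ {a, b, c} :=
    convexHull_triple_subset hK (subset_convexHull _ _ (by simp)) (subset_convexHull _ _ (by simp))
      (subset_convexHull _ _ (by simp))
  have hc := isCompact_convexHull_triple a b c
  exact (subset_outer_of_unbounded (hK.isPreconnected_compl_of_isCompact hc)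
    (disjoint_left.2 fun z hz hzD => hz (hs hzD)) (not_isBounded_compl hc.isBounded) hqK).2 hq.2

lemma mem_triple_of_adj_triInterior (E : PlaneEmb G) {x y z a b : V} (hxy : G.Adj x y)
    (hyz : G.Adj y z) (hxz : G.Adj x z) (hab : G.Adj a b)
    (ha : E.pos a ∈ triInterior (E.pos x) (E.pos y) (E.pos z))
    (hb : E.pos b ∉ triInterior (E.pos x) (E.pos y) (E.pos z)) : b = x ∨ b = y ∨ b = z := by
  by_contra! h
  obtain ⟨hbx, hby, hbz⟩ := h
  have hax : a ≠ x := by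
    rintro rfl; exact ha.1 (Or.inl (Or.inl (left_mem_seg _ _)))
  have hay : a ≠ y := by
    rintro rfl; exact ha.1 (Or.inl (Or.inl (right_mem_seg _ _)))
  have haz : a ≠ z := by
    rintro rfl; exact ha.1 (Or.inr (right_mem_seg _ _))
  have key : ∀ c d, G.Adj c d → a ≠ c → a ≠ d → b ≠ c → b ≠ d →
      Disjoint (seg (E.pos a) (E.pos b)) (seg (E.pos c) (E.pos d)) := by
    intro c d hcd h1 h2 h3 h4
    refine disjoint_left.2 fun q hq hq' => ?_
    have := E.edges_meet hab hcd (fun h => by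
      rcases Sym2.eq_iff.1 h with ⟨h, -⟩ | ⟨h, -⟩
      · exact h1 h
      · exact h2 h) ⟨hq, hq'⟩
    obtain ⟨rfl | rfl, h | h⟩ := this
    · exact h1 (E.inj h)
    · exact h2 (E.inj h)
    · exact h3 (E.inj h)
    · exact h4 (E.inj h)
  have hd : Disjoint (seg (E.pos a) (E.pos b)) (triBoundary (E.pos x) (E.pos y) (E.pos z)) :=
    ((key x y hxy hax hay hbx hby).union_right (key y z hyz hay haz hby hbz)).union_right
      (key x z hxz hax haz hbx hbz)
  have hbo : E.pos b ∈ outer (triBoundary (E.pos x) (E.pos y) (E.pos z)) :=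
    ⟨disjoint_left.1 hd (right_mem_seg _ _), fun hb' =>
      hb ⟨disjoint_left.1 hd (right_mem_seg _ _), hb'⟩⟩
  exact (subset_outer (isPreconnected_seg _ _) hd ⟨_, right_mem_seg _ _, hbo⟩
    (left_mem_seg _ _)).2 ha.2

namespace Cfg4

variable {C : Cfg4}

lemma notMem_onFace_of_triInterior (hC : C.Valid) {x y z w : Fin C.n} (hxy : C.G.Adj x y)
    (hyz : C.G.Adj y z) (hxz : C.G.Adj x z)
    (hw : C.E.pos w ∈ triInterior (C.E.pos x) (C.E.pos y) (C.E.pos z)) :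
    w ∉ C.E.onFace C.F := by
  intro h
  have hT : triBoundary (C.E.pos x) (C.E.pos y) (C.E.pos z) ⊆ C.E.drawing := by
    rw [← draw_univ]
    exact union_subset (union_subset (seg_subset_draw (mem_univ _) (mem_univ _) hxy)
      (seg_subset_draw (mem_univ _) (mem_univ _) hyz))
      (seg_subset_draw (mem_univ _) (mem_univ _) hxz)
  have h' : C.E.pos w ∈ closure C.F := h
  rw [hC.2.1.eq_outer] at h'
  rcases closure_outer_subset (isCompact_triBoundary _ _ _) (closure_mono (outer_anti hT) h')
    with h | h
  · exact hw.1 h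
  · exact h.2 hw.2

/-- A triangle with a vertex whose list has at least two colors encloses no vertex. -/
lemma MinCounterexample.notMem_triInterior (hC : C.MinCounterexample) {x y z : Fin C.n}
    (hxy : C.G.Adj x y) (hyz : C.G.Adj y z) (hxz : C.G.Adj x z) (hL : 2 ≤ (C.L y).card)
    (w : Fin C.n) : C.E.pos w ∉ triInterior (C.E.pos x) (C.E.pos y) (C.E.pos z) := by
  intro hw
  set I := triInterior (C.E.pos x) (C.E.pos y) (C.E.pos z) with hI
  set K := convexHull ℝ {C.E.pos x, C.E.pos y, C.E.pos z} with hK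
  have hface : ∀ v, C.E.pos v ∈ I → v ∉ C.E.onFace C.F := fun v hv =>
    notMem_onFace_of_triInterior hC.1 hxy hyz hxz hv
  have hPF := hC.1.2.2.2.2.1
  have h3 := hC.1.2.2.2.2.2.2.2.2.1
  have hxI : C.E.pos x ∉ I := fun h => h.1 (Or.inl (Or.inl (left_mem_seg _ _)))
  have hyI : C.E.pos y ∉ I := fun h => h.1 (Or.inl (Or.inl (right_mem_seg _ _)))
  have hzI : C.E.pos z ∉ I := fun h => h.1 (Or.inr (right_mem_seg _ _))
  obtain ⟨φ, f1, f2⟩ := hC.exists_coloring_of_path_subset (S := {v | C.E.pos v ∉ I}) le_rfl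
    (Or.inl fun h => (h ▸ mem_univ w : w ∈ {v | C.E.pos v ∉ I}) hw)
    (fun p hp hpI => hface p hpI (hPF p hp)) (fun _ _ _ _ h => h)
  set S : Set (Fin C.n) := {v | C.E.pos v ∈ I ∨ v = x ∨ v = y ∨ v = z} with hS
  have hxK : C.E.pos x ∈ K := subset_convexHull _ _ (by simp)
  have hyK : C.E.pos y ∈ K := subset_convexHull _ _ (by simp)
  have hzK : C.E.pos z ∈ K := subset_convexHull _ _ (by simp)
  have hKc : Convex ℝ K := convex_convexHull _ _
  have hSK : ∀ v ∈ S, C.E.pos v ∈ K := by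
    rintro v (h | rfl | rfl | rfl)
    · exact triInterior_subset_convexHull _ _ _ h
    · exact hxK
    · exact hyK
    · exact hzK
  have hdK : draw C.E.pos S C.G ⊆ K := by
    rintro p (⟨a, ha, rfl⟩ | ⟨a, ha, b, hb, -, hp⟩)
    · exact hSK a ha
    · exact hKc.segment_subset (hSK a ha) (hSK b hb) hp
  have hKcomp : IsCompact K := isCompact_convexHull_triple _ _ _
  have hcl : closure Kᶜ ⊆ closure (outer (draw C.E.pos S C.G)) :=
    closure_mono (subset_outer_of_unbounded (hKc.isPreconnected_compl_of_isCompact hKcomp)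
      (disjoint_left.2 fun q hq hqd => hq (hdK hqd)) (not_isBounded_compl hKcomp.isBounded))
  have hs1 : seg (C.E.pos x) (C.E.pos y) ⊆ closure (outer (draw C.E.pos S C.G)) :=
    (seg_subset_closure_compl_convexHull (C.E.inj.ne hxy.ne) _).trans hcl
  have hs2 : seg (C.E.pos y) (C.E.pos z) ⊆ closure (outer (draw C.E.pos S C.G)) := by
    have := (seg_subset_closure_compl_convexHull (C.E.inj.ne hyz.ne) (C.E.pos x))
    refine this.trans (Eq.trans_subset ?_ hcl)
    rw [hK]; congr 3; ext q; simp only [mem_insert_iff, mem_singleton_iff]; tauto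
  obtain ⟨χ, g1, g2, g3⟩ := hC.exists_coloring (S := S) (P := [x, y, z]) (ψ := φ) le_rfl
    (Or.inr (Or.inr ⟨y, by simp, hL⟩)) (by simp [hxy.ne, hyz.ne, hxz.ne]) (by simp)
    (by simp [hS])
    (by
      simp only [List.mem_cons, List.not_mem_nil, or_false, forall_eq_or_imp, forall_eq]
      exact ⟨hs1 (left_mem_seg _ _), hs1 (right_mem_seg _ _), hs2 (right_mem_seg _ _)⟩)
    (by simpa using ⟨⟨hxy, hs1⟩, hyz, hs2⟩)
    (by simpa using ⟨f1 x hxI, f1 y hyI, f1 z hzI⟩)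
    (by
      have : ∀ p ∈ [x, y, z], C.E.pos p ∉ I := by simpa using ⟨hxI, hyI, hzI⟩
      exact fun p hp q hq => f2 p (this p hp) q (this q hq))
    (by
      rintro v (h | h) hvP
      · exact absurd (hPF v hvP) (hface v h)
      · simpa using h)
    (by
      rintro v (h | h) hvP h2
      · have := h3 v (hface v h); omega
      · exact absurd (by simpa using h) hvP)
  refine false_of_glue hC.2.1 (S₁ := {v | C.E.pos v ∉ I}) (S₂ := S) (φ₁ := φ) (φ₂ := χ)
    (fun v => ?_) (fun a b hab => ?_) f1 g1 f2 g3 (fun v hv hv' => ?_)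
  · by_cases h : C.E.pos v ∈ I
    · exact Or.inr (Or.inl h)
    · exact Or.inl h
  · by_cases ha : C.E.pos a ∈ I <;> by_cases hb : C.E.pos b ∈ I
    · exact Or.inr ⟨Or.inl ha, Or.inl hb⟩
    · exact Or.inr ⟨Or.inl ha, Or.inr (mem_triple_of_adj_triInterior _ hxy hyz hxz hab ha hb)⟩
    · exact Or.inr ⟨Or.inr (mem_triple_of_adj_triInterior _ hxy hyz hxz hab.symm hb ha), Or.inl hb⟩
    · exact Or.inl ⟨ha, hb⟩
  · exact g2 v (by simpa using hv'.resolve_left hv)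

end Cfg4

/-- The edge `uv` splits the remaining vertices into two sides `A` and `B`, and `uv` is visible
from infinity in the drawing of each of the two parts. -/
structure PlaneEmb.IsSplit (E : PlaneEmb G) (u v : V) (A B : Set V) : Prop where
  mem_or : ∀ w, w ∈ A ∨ w ∈ B ↔ w ≠ u ∧ w ≠ v
  disjoint : Disjoint A B
  not_adj : ∀ a ∈ A, ∀ b ∈ B, ¬ G.Adj a b
  seg_left : seg (E.pos u) (E.pos v) ⊆ closure (outer (draw E.pos (insert u (insert v A)) G))
  seg_right : seg (E.pos u) (E.pos v) ⊆ closure (outer (draw E.pos (insert u (insert v B)) G))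

namespace PlaneEmb.IsSplit

variable {E : PlaneEmb G} {u v : V} {A B : Set V}

lemma symm (h : E.IsSplit u v A B) : E.IsSplit u v B A :=
  ⟨fun w => by rw [or_comm, h.mem_or], h.disjoint.symm,
    fun b hb a ha hba => h.not_adj a ha b hb hba.symm, h.seg_right, h.seg_left⟩

lemma swap (h : E.IsSplit u v A B) : E.IsSplit v u A B :=
  ⟨fun w => by rw [h.mem_or, and_comm], h.disjoint, h.not_adj,
    by rw [seg_comm, insert_comm]; exact h.seg_left,
    by rw [seg_comm, insert_comm]; exact h.seg_right⟩

lemma ne_of_mem_left (h : E.IsSplit u v A B) {w : V} (hw : w ∈ A) : w ≠ u ∧ w ≠ v :=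
  (h.mem_or w).1 (Or.inl hw)

lemma ne_of_mem_right (h : E.IsSplit u v A B) {w : V} (hw : w ∈ B) : w ≠ u ∧ w ≠ v :=
  (h.mem_or w).1 (Or.inr hw)

lemma notMem_right (h : E.IsSplit u v A B) {w : V} (hw : w ∈ A) : w ∉ B :=
  fun hw' => disjoint_left.1 h.disjoint hw hw'

lemma mem_left_of_notMem (h : E.IsSplit u v A B) {w : V} (hw : w ∉ B) :
    w ∈ insert u (insert v A) := by
  by_contra hn
  rw [mem_insert_iff, mem_insert_iff, not_or, not_or] at hn
  exact ((h.mem_or w).2 ⟨hn.1, hn.2.1⟩).elim hn.2.2 hw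

lemma edge_mem (h : E.IsSplit u v A B) {a b : V} (hab : G.Adj a b) :
    a ∈ insert u (insert v A) ∧ b ∈ insert u (insert v A) ∨
      a ∈ insert u (insert v B) ∧ b ∈ insert u (insert v B) := by
  by_cases ha : a ∈ B
  · exact Or.inr ⟨Or.inr (Or.inr ha), h.symm.mem_left_of_notMem fun hb => h.not_adj b hb a ha hab.symm⟩
  by_cases hb : b ∈ B
  · exact Or.inr ⟨h.symm.mem_left_of_notMem fun ha => h.not_adj a ha b hb hab, Or.inr (Or.inr hb)⟩
  · exact Or.inl ⟨h.mem_left_of_notMem ha, h.mem_left_of_notMem hb⟩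

end PlaneEmb.IsSplit

lemma PlaneEmb.BoundaryEdge.symm {E : PlaneEmb G} {F : Set (ℝ × ℝ)} {u v : V}
    (h : E.BoundaryEdge F u v) : E.BoundaryEdge F v u :=
  ⟨h.1.symm, by rw [seg_comm]; exact h.2⟩

namespace Cfg4

variable {C : Cfg4}

lemma IsChord.symm {u v : Fin C.n} (h : C.IsChord u v) : C.IsChord v u :=
  ⟨h.1.symm, h.2.2.1, h.2.1, fun hb => h.2.2.2 hb.symm⟩

lemma IsChord.exists_isSplit (hC : C.Valid) {u v : Fin C.n} (h : C.IsChord u v) :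
    ∃ A B, C.E.IsSplit u v A B := by
  have hF := hC.2.1.eq_outer
  obtain ⟨A, B, h1, h2, h3, h4, h5⟩ := exists_chord_split C.E h.1 (hF ▸ h.2.1) (hF ▸ h.2.2.1)
  exact ⟨A, B, h1, h2, h3, h4, h5⟩

lemma IsChord.nonempty_right (hC : C.Valid) {u v : Fin C.n} (h : C.IsChord u v)
    {A B : Set (Fin C.n)} (hs : C.E.IsSplit u v A B) : B.Nonempty := by
  by_contra hB
  rw [not_nonempty_iff_eq_empty] at hB
  refine h.2.2.2 ⟨h.1, ?_⟩
  have huniv : insert u (insert v A) = univ :=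
    eq_univ_of_forall fun w => hs.mem_left_of_notMem (by simp [hB])
  have := hs.seg_left
  rwa [huniv, draw_univ, ← hC.2.1.eq_outer] at this

/-- If one side of a chord misses the precolored path, then that side contains a common neighbor
of the ends of the chord with two colors. -/
lemma MinCounterexample.exists_of_side (hC : C.MinCounterexample) {u v : Fin C.n}
    (h : C.IsChord u v) {A B : Set (Fin C.n)} (hs : C.E.IsSplit u v A B)
    (hP : ∀ p ∈ C.P, p ∉ B) :
    ∃ x, (C.L x).card = 2 ∧ x ∉ C.P ∧ C.G.Adj x u ∧ C.G.Adj x v := by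
  by_contra! hx
  obtain ⟨b, hb⟩ := h.nonempty_right hC.1 hs
  obtain ⟨a, ha⟩ := h.nonempty_right hC.1 hs.symm
  have hbS : b ∉ insert u (insert v A) := by
    have := hs.ne_of_mem_right hb
    simpa [this.1, this.2] using hs.symm.notMem_right hb
  have haS : a ∉ insert u (insert v B) := by
    have := hs.ne_of_mem_left ha
    simpa [this.1, this.2] using hs.notMem_right ha
  obtain ⟨φ, f1, f2⟩ := hC.exists_coloring_of_path_subset (S := insert u (insert v A)) le_rfl
    (Or.inl fun h => hbS (h ▸ mem_univ b)) (fun p hp => hs.mem_left_of_notMem (hP p hp))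
    (fun _ _ _ _ h => h)
  have hu : u ∈ insert u (insert v A) := Or.inl rfl
  have hv : v ∈ insert u (insert v A) := Or.inr (Or.inl rfl)
  obtain ⟨χ, g1, g2, g3⟩ := hC.exists_coloring (S := insert u (insert v B)) (P := [u, v]) (ψ := φ)
    le_rfl (Or.inl fun h => haS (h ▸ mem_univ a)) (by simp [h.1.ne]) (by simp) (by simp)
    (by simpa using ⟨hs.seg_right (left_mem_seg _ _), hs.seg_right (right_mem_seg _ _)⟩)
    (by simpa using ⟨h.1, hs.seg_right⟩) (by simpa using ⟨f1 u hu, f1 v hv⟩)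
    (by simpa using ⟨f2 u hu v hv, f2 v hv u hu⟩)
    (by
      rintro w (rfl | rfl | hw) hwP
      · simp
      · simp
      · exact absurd hw (hP w hwP))
    (by
      intro x hxS hxP hx2 p hp q hq hpq hxp hxq
      have hxB : x ∈ B := by
        rcases hxS with rfl | rfl | hxB
        · simp at hxP
        · simp at hxP
        · exact hxB
      have := hx x hx2 fun h => hP x h hxB
      simp only [List.mem_cons, List.not_mem_nil, or_false] at hp hq
      rcases hp with rfl | rfl <;> rcases hq with rfl | rfl
      · exact hpq rfl
      · exact this hxp hxq
      · exact this hxq hxp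
      · exact hpq rfl)
  refine false_of_glue hC.2.1 (fun w => ?_) (fun a b hab => hs.edge_mem hab) f1 g1 f2 g3
    (fun w hw hw' => g2 w ?_)
  · by_cases hw : w ∈ B
    · exact Or.inr (Or.inr (Or.inr hw))
    · exact Or.inl (hs.mem_left_of_notMem hw)
  · rcases hw' with rfl | rfl | hw'
    · simp
    · simp
    · have := hs.ne_of_mem_right hw'
      rcases hw with rfl | rfl | hw
      · simp
      · simp
      · exact absurd hw' (hs.notMem_right hw)

lemma MinCounterexample.path_across_aux (hC : C.MinCounterexample) {u v p q : Fin C.n}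
    (h : C.IsChord u v) {A B : Set (Fin C.n)} (hs : C.E.IsSplit u v A B)
    (hP : ∀ w, w ∈ C.P ↔ w = p ∨ w = u ∨ w = q) (hpu : C.E.BoundaryEdge C.F p u)
    (huq : C.E.BoundaryEdge C.F u q) (hp : p ∈ A) (hq : q ∈ B) (hvq : ¬ C.G.Adj v q) : False := by
  have hval := hC.1
  obtain ⟨h4, -, -, -, hPF, -, -, -, -, -, -, -, ⟨ψ, hψ, hψ'⟩, hvi⟩ := hC.1
  have hpP : p ∈ C.P := (hP p).2 (Or.inl rfl)
  have huP : u ∈ C.P := (hP u).2 (Or.inr (Or.inl rfl))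
  have hqP : q ∈ C.P := (hP q).2 (Or.inr (Or.inr rfl))
  have hpn := hs.ne_of_mem_left hp
  have hqn := hs.ne_of_mem_right hq
  have hvP : v ∉ C.P := fun hv => by
    rcases (hP v).1 hv with rfl | rfl | rfl
    · exact hpn.2 rfl
    · exact h.1.ne rfl
    · exact hqn.2 rfl
  have hpS : p ∉ insert u (insert v B) := by simpa [hpn.1, hpn.2] using hs.notMem_right hp
  have hqS : q ∉ insert u (insert v A) := by simpa [hqn.1, hqn.2] using hs.symm.notMem_right hq
  have hcl := fun S => closure_subset hval (S := S) (le_refl C.G)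
  obtain ⟨φ, f1, f2, f3⟩ := hC.exists_coloring (S := insert u (insert v A)) (P := [p, u]) (ψ := ψ)
    le_rfl (Or.inl fun h => hqS (h ▸ mem_univ q)) (by simp [hpn.1]) (by simp) (by simp [hp])
    (by simpa using ⟨hcl _ (hPF p hpP), hcl _ (hPF u huP)⟩)
    (by simpa using ⟨hpu.1, hpu.2.trans (hcl _)⟩) (by simpa using ⟨hψ p hpP, hψ u huP⟩)
    (by simpa using ⟨fun h => hψ' hpP huP h, fun h => hψ' huP hpP h⟩)
    (by
      intro w hw hwP
      rcases (hP w).1 hwP with rfl | rfl | rfl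
      · simp
      · simp
      · exact absurd hw hqS)
    (by
      have hmem : ∀ w ∈ [p, u], w ∈ C.P := by simpa using ⟨hpP, huP⟩
      exact fun x _ _ hx2 a ha b hb hab => hvi x hx2 a (hmem a ha) b (hmem b hb) hab)
  have hu : u ∈ insert u (insert v A) := Or.inl rfl
  have hv : v ∈ insert u (insert v A) := Or.inr (Or.inl rfl)
  have hφu : φ u = ψ u := f2 u (by simp)
  have e1 : Function.update ψ v (φ v) v = φ v := Function.update_self ..
  have e2 : Function.update ψ v (φ v) u = ψ u := Function.update_of_ne h.1.ne _ _
  have e3 : Function.update ψ v (φ v) q = ψ q := Function.update_of_ne hqn.2 _ _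
  have hvu : φ v ≠ ψ u := hφu ▸ f3 v hv u hu h.1.symm
  obtain ⟨χ, g1, g2, g3⟩ := hC.exists_coloring (S := insert u (insert v B)) (P := [v, u, q])
    (ψ := Function.update ψ v (φ v)) le_rfl (Or.inl fun h => hpS (h ▸ mem_univ p))
    (by simp [h.1.ne', hqn.1.symm, hqn.2.symm]) (by simp) (by simp [hq])
    (by simpa using ⟨hs.seg_right (right_mem_seg _ _), hs.seg_right (left_mem_seg _ _),
          hcl _ (hPF q hqP)⟩)
    (by
      have := hs.seg_right
      rw [seg_comm] at this
      simpa using ⟨⟨h.1.symm, this⟩, huq.1, huq.2.trans (hcl _)⟩)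
    (by
      simp only [List.mem_cons, List.not_mem_nil, or_false, forall_eq_or_imp, forall_eq, e1, e2, e3]
      exact ⟨f1 v hv, hψ u huP, hψ q hqP⟩)
    (by
      simp only [List.mem_cons, List.not_mem_nil, or_false, forall_eq_or_imp, forall_eq, e1, e2, e3]
      exact ⟨⟨fun h => absurd h (C.G.irrefl), fun _ => hvu, fun h => absurd h hvq⟩,
        ⟨fun _ => hvu.symm, fun h => absurd h (C.G.irrefl), fun h => hψ' huP hqP h⟩,
        ⟨fun h => absurd h.symm hvq, fun h => hψ' hqP huP h, fun h => absurd h (C.G.irrefl)⟩⟩)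
    (by
      intro w hw hwP
      rcases (hP w).1 hwP with rfl | rfl | rfl
      · exact absurd hw hpS
      · simp
      · simp)
    (by
      intro x hxS hxQ hx2
      simp only [List.mem_cons, List.not_mem_nil, or_false, not_or] at hxQ
      have hxP : x ∉ C.P := fun hx => by
        rcases (hP x).1 hx with rfl | rfl | rfl
        · exact hpS hxS
        · exact hxQ.2.1 rfl
        · exact hxQ.2.2 rfl
      have k1 : C.G.Adj x v → C.G.Adj x u → False := fun hxv hxu =>
        hC.not_triangle huP hxP hvP hxu.symm hxv h.1
      have k2 : C.G.Adj x u → C.G.Adj x q → False := hvi x hx2 u huP q hqP hqn.1.symm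
      have k3 : C.G.Adj x v → C.G.Adj x q → False := fun hxv hxq =>
        not_adj_both h4 hxv h.1.symm huq.1 hxq.symm hxQ.2.1 hqn.2.symm
      intro a ha b hb hab hxa hxb
      simp only [List.mem_cons, List.not_mem_nil, or_false] at ha hb
      rcases ha with rfl | rfl | rfl <;> rcases hb with rfl | rfl | rfl <;> tauto)
  refine false_of_glue hC.2.1 (fun w => ?_) (fun a b hab => hs.edge_mem hab) f1 g1 f3 g3
    (fun w hw hw' => ?_)
  · by_cases hw : w ∈ B
    · exact Or.inr (Or.inr (Or.inr hw))
    · exact Or.inl (hs.mem_left_of_notMem hw)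
  · have huv : w = u ∨ w = v := by
      rcases hw with rfl | rfl | hw
      · exact Or.inl rfl
      · exact Or.inr rfl
      · have := hs.ne_of_mem_left hw
        rcases hw' with rfl | rfl | hw'
        · exact Or.inl rfl
        · exact Or.inr rfl
        · exact absurd hw' (hs.notMem_right hw)
    rcases huv with rfl | rfl
    · rw [g2 w (by simp), e2, hφu]
    · rw [g2 w (by simp), e1]

/-- No chord separates the two ends of the precolored path from each other. -/
lemma MinCounterexample.path_across (hC : C.MinCounterexample) {u v p q : Fin C.n}
    (h : C.IsChord u v) {A B : Set (Fin C.n)} (hs : C.E.IsSplit u v A B)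
    (hP : ∀ w, w ∈ C.P ↔ w = p ∨ w = u ∨ w = q) (hpu : C.E.BoundaryEdge C.F p u)
    (huq : C.E.BoundaryEdge C.F u q) (hp : p ∈ A) (hq : q ∈ B) : False := by
  by_cases hvq : C.G.Adj v q
  · by_cases hvp : C.G.Adj v p
    · exact not_adj_both hC.1.1 hvp.symm hvq huq.1.symm hpu.1.symm
        (fun e => hs.notMem_right hp (e ▸ hq)) h.1.ne'
    · exact hC.path_across_aux h hs.symm (fun w => by rw [hP]; tauto) huq.symm hpu.symm hq hp hvp
  · exact hC.path_across_aux h hs hP hpu huq hp hq hvq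

/-- The ends of every chord have a common neighbor with two colors. -/
lemma MinCounterexample.exists_of_chord (hC : C.MinCounterexample) {u v : Fin C.n}
    (h : C.IsChord u v) : ∃ x, (C.L x).card = 2 ∧ x ∉ C.P ∧ C.G.Adj x u ∧ C.G.Adj x v := by
  obtain ⟨A, B, hs⟩ := h.exists_isSplit hC.1
  by_cases hA : ∀ p ∈ C.P, p ∉ A
  · exact hC.exists_of_side h hs.symm hA
  by_cases hB : ∀ p ∈ C.P, p ∉ B
  · exact hC.exists_of_side h hs hB
  exfalso
  push Not at hA hB
  obtain ⟨p, hpP, hp⟩ := hA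
  obtain ⟨q, hqP, hq⟩ := hB
  have hpq := hs.not_adj p hp q hq
  have hne : p ≠ q := fun e => hs.notMem_right hp (e ▸ hq)
  have hmid : ∀ m, C.E.BoundaryEdge C.F p m → C.E.BoundaryEdge C.F m q →
      (∀ w, w ∈ C.P ↔ w = p ∨ w = m ∨ w = q) → False := by
    intro m hpm hmq hPm
    have hmA : m ∉ A := fun hm => hs.not_adj m hm q hq hmq.1
    have hmB : m ∉ B := fun hm => hs.not_adj p hp m hm hpm.1
    rcases hs.mem_left_of_notMem hmB with rfl | rfl | hm
    · exact hC.path_across h hs hPm hpm hmq hp hq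
    · exact hC.path_across h.symm hs.swap hPm hpm hmq hp hq
    · exact hmA hm
  obtain ⟨-, -, -, hlen, -, hch, -⟩ := hC.1
  replace hch : C.P.IsChain _ := hch
  generalize C.P = P at hpP hqP hlen hch hmid
  have hsym : ∀ a b, C.E.BoundaryEdge C.F a b → C.G.Adj a b ∧ C.G.Adj b a := fun a b hab =>
    ⟨hab.1, hab.1.symm⟩
  match P, hlen with
  | [], _ => simp at hpP
  | [a], _ => simp_all
  | [a, b], _ =>
    simp only [List.isChain_cons_cons, List.isChain_singleton, and_true] at hch
    have := hsym a b hch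
    simp only [List.mem_cons, List.not_mem_nil, or_false] at hpP hqP
    rcases hpP with rfl | rfl <;> rcases hqP with rfl | rfl <;> tauto
  | [a, b, c], _ =>
    simp only [List.isChain_cons_cons, List.isChain_singleton, and_true] at hch
    have h1 := hsym a b hch.1
    have h2 := hsym b c hch.2
    simp only [List.mem_cons, List.not_mem_nil, or_false] at hpP hqP hmid
    rcases hpP with rfl | rfl | rfl <;> rcases hqP with rfl | rfl | rfl
    · tauto
    · tauto
    · exact hmid b hch.1 hch.2 fun w => Iff.rfl
    · tauto
    · tauto
    · tauto
    · exact hmid b hch.2.symm hch.1.symm fun w => by tauto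
    · tauto
    · tauto

end Cfg4

/-- **Claims 5 and 6 in the proof of Theorem 6.** In a minimum counterexample to
Theorem 6, every chord of the outer cycle is bad, and no endpoint of a chord lies
on the precolored path `P`. -/
theorem min_cex_C4free_chords_bad_and_off_P (C : Cfg4) (hC : C.MinCounterexample) :
    ∀ u v : Fin C.n, C.IsChord u v → C.IsBadChord u v ∧ u ∉ C.P ∧ v ∉ C.P := by
  intro u v h
  obtain ⟨-, -, -, -, -, -, -, -, h9, -, -, h12, -, hvi⟩ := hC.1
  have hface : ∀ x, (C.L x).card = 2 → x ∈ C.E.onFace C.F := fun x hx => by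
    by_contra hn
    have := h9 x hn
    omega
  obtain ⟨x, hx2, hxP, hxu, hxv⟩ := hC.exists_of_chord h
  have hbd : ∀ w, w ∈ C.E.onFace C.F → C.G.Adj x w → C.E.BoundaryEdge C.F x w := by
    intro w hw hxw
    by_contra hb
    obtain ⟨y, hy2, -, hyx, -⟩ := hC.exists_of_chord ⟨hxw, hface x hx2, hw, hb⟩
    exact h12 hyx hy2 hx2
  have hoff : ∀ w w', C.G.Adj w w' → C.G.Adj x w → C.G.Adj x w' → w ∉ C.P := by
    intro w w' hww' hxw hxw' hw
    by_cases hw' : w' ∈ C.P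
    · exact hvi x hx2 w hw w' hw' hww'.ne hxw hxw'
    · exact hC.not_triangle hw hxP hw' hxw.symm hxw' hww'
  exact ⟨⟨h, x, hx2, hxu.symm, hxv, (hbd u h.2.1 hxu).symm, hbd v h.2.2.1 hxv,
    hC.notMem_triInterior hxu.symm hxv h.1 hx2.ge⟩, hoff u v h.1 hxu hxv,
    hoff v u h.1.symm hxv hxu⟩

end ChoosSep
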